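/- Let n ≥ 1, ε > 0, and let a : ℝⁿ → Mₙ(ℝ) be a measurable matrix-valued function satisfying ε·Iₙ ≤ a(x) ≤ ε⁻¹·Iₙ (in the positive semidefinite order) for all x. There exists a constant C = C(n, ε) such that for every nonnegative C¹ function f : B₄(0) → ℝ that is a weak solution of ∂_j(a^{ij}(x) ∂_i f(x)) = 0 on B₄(0) — i.e. ∫_{B₄(0)} ⟨a(x)·∇f(x), ∇φ(x)⟩ dx = 0 for every smooth φ compactly supported in B₄(0) — one has sup_{B₁(0)} f ≤ C · inf_{B₁(0)} f. -/

import Mathlib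

open Matrix MeasureTheory Metric Real

noncomputable section

/-- `ℝⁿ` with the Euclidean structure. -/
abbrev En (n : ℕ) := EuclideanSpace ℝ (Fin n)

/-- The partial derivative `∂ᵢ f (x)`. -/
def pdrv (n : ℕ) (i : Fin n) (f : En n → ℝ) (x : En n) : ℝ :=
  fderiv ℝ f x (EuclideanSpace.single i 1)

/-- The gradient `∇f(x)` as a vector in `Fin n → ℝ`. -/
def gradv (n : ℕ) (f : En n → ℝ) (x : En n) : Fin n → ℝ := fun i => pdrv n i f x

lemma gradv_dot_self (n : ℕ) (f : En n → ℝ) (x : En n) :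
    gradv n f x ⬝ᵥ gradv n f x = ‖fderiv ℝ f x‖ ^ 2 := by
  set L := fderiv ℝ f x with hL
  set g := (InnerProductSpace.toDual ℝ (En n)).symm L with hg
  have h1 : ‖L‖ = ‖g‖ := by simp [hg]
  have h2 : ∀ i, gradv n f x i = g i := by
    intro i
    have : L (EuclideanSpace.single i 1) = inner ℝ g (EuclideanSpace.single i (1:ℝ)) := by
      rw [hg, InnerProductSpace.toDual_symm_apply]
    simp only [gradv, pdrv]
    rw [← hL, this, EuclideanSpace.inner_single_right]
    simp
  rw [h1, EuclideanSpace.norm_sq_eq]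
  simp [dotProduct, h2, sq]

lemma sup_le_one_dim (u : En 1 → ℝ) (hu : ContDiff ℝ 1 u) (hc : HasCompactSupport u) (x : En 1) :
    ‖u x‖ₑ ≤ ∫⁻ y, ‖fderiv ℝ u y‖ₑ := by
  let L : ℝ →L[ℝ] En 1 := ContinuousLinearMap.toSpanSingleton ℝ (EuclideanSpace.single (0 : Fin 1) (1:ℝ))
  have hLa : ∀ t, L t = WithLp.toLp 2 ((MeasurableEquiv.funUnique (Fin 1) ℝ).symm t) := by
    intro t
    ext i
    fin_cases i
    simp [L]
  have hLiso : Isometry L := by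
    apply AddMonoidHomClass.isometry_of_norm
    intro t
    simp [L, norm_smul]
  have hmp : MeasurePreserving L volume volume := by
    have h1 := (volume_preserving_funUnique (Fin 1) ℝ).symm
    have h2 := (PiLp.volume_preserving_toLp (Fin 1)).comp h1
    convert! h2 using 1
    ext1 t
    simp [hLa t]
  have hx : L (x 0) = x := by
    ext i
    fin_cases i
    simp [L]
  have h1 := HasCompactSupport.enorm_le_lintegral_Ici_deriv (f := u ∘ L)
    (hu.comp L.contDiff) (hc.comp_isClosedEmbedding hLiso.isClosedEmbedding) (x 0)
  simp only [Function.comp, hx] at h1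
  refine h1.trans ((lintegral_mono' Measure.restrict_le_self le_rfl).trans ?_)
  rw [← hmp.lintegral_comp]
  · apply lintegral_mono
    intro t
    have hd : HasDerivAt (fun s => u (L s)) (fderiv ℝ u (L t) (EuclideanSpace.single 0 1)) t := by
      have := ((hu.differentiable one_ne_zero) (L t)).hasFDerivAt.comp_hasDerivAt t L.hasDerivAt
      convert! this using 2
      simp [L]
    change ‖deriv (fun s => u (L s)) t‖ₑ ≤ ‖fderiv ℝ u (L t)‖ₑ
    rw [hd.deriv]
    refine (ContinuousLinearMap.le_opENorm _ _).trans ?_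
    have : ‖(EuclideanSpace.single (0:Fin 1) (1:ℝ) : En 1)‖ₑ = 1 := by
      rw [← ofReal_norm]
      simp
    rw [this, mul_one]
  · exact (hu.continuous_fderiv one_ne_zero).measurable.enorm

lemma norm_fderiv_sq_le (n : ℕ) (φ : En n → ℝ) (hφ : ContDiff ℝ 1 φ) (x : En n) :
    ‖fderiv ℝ (fun y => φ y ^ 2) x‖ ≤ φ x ^ 2 + ‖fderiv ℝ φ x‖ ^ 2 := by
  have hd := (hφ.differentiable one_ne_zero) x
  have : fderiv ℝ (fun y => φ y ^ 2) x = (2 * φ x) • fderiv ℝ φ x := by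
    have := (hd.hasFDerivAt.pow 2).fderiv
    rw [this]; simp
  rw [this, norm_smul, Real.norm_eq_abs, abs_mul, abs_two]
  nlinarith [sq_nonneg (|φ x| - ‖fderiv ℝ φ x‖), sq_abs (φ x)]

lemma integrable_cs (n : ℕ) {f : En n → ℝ} (hf : Continuous f) (hc : HasCompactSupport f) :
    Integrable f := hf.integrable_of_hasCompactSupport hc

lemma integrable_sq (n : ℕ) {φ : En n → ℝ} (hφ : Continuous φ) (hc : HasCompactSupport φ) :
    Integrable (fun x => φ x ^ 2) :=
  integrable_cs n (hφ.pow 2) (hc.comp_left (g := fun t : ℝ => t ^ 2) (by simp))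

lemma integrable_fderiv_sq (n : ℕ) {φ : En n → ℝ} (hφ : ContDiff ℝ 1 φ)
    (hc : HasCompactSupport φ) : Integrable (fun x => ‖fderiv ℝ φ x‖ ^ 2) :=
  integrable_cs n ((hφ.continuous_fderiv one_ne_zero).norm.pow 2)
    ((hc.fderiv ℝ).comp_left (g := fun t : En n →L[ℝ] ℝ => ‖t‖ ^ 2) (by simp))

lemma lintegral_fderiv_sq_le (n : ℕ) (φ : En n → ℝ) (hφ : ContDiff ℝ 1 φ)
    (hc : HasCompactSupport φ) :
    ∫⁻ x, ‖fderiv ℝ (fun y => φ y ^ 2) x‖ₑ ≤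
      ENNReal.ofReal (∫ x, (φ x ^ 2 + ‖fderiv ℝ φ x‖ ^ 2)) := by
  have hcd : Continuous (fderiv ℝ φ) := hφ.continuous_fderiv one_ne_zero
  have hIntg : Integrable (fun x => φ x ^ 2 + ‖fderiv ℝ φ x‖ ^ 2) :=
    (integrable_sq n hφ.continuous hc).add (integrable_fderiv_sq n hφ hc)
  rw [ofReal_integral_eq_lintegral_ofReal hIntg (Filter.Eventually.of_forall fun x => by positivity)]
  apply lintegral_mono
  intro x
  beta_reduce
  rw [← ofReal_norm]
  exact ENNReal.ofReal_le_ofReal (norm_fderiv_sq_le n φ hφ x)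

/-- Sobolev inequality. -/
lemma sobolev (n : ℕ) (hn : 1 ≤ n) : ∃ χ : ℝ, 1 < χ ∧ ∃ C : ℝ, 0 < C ∧
    ∀ φ : En n → ℝ, ContDiff ℝ 1 φ → HasCompactSupport φ →
      ∫ x, |φ x| ^ (2 * χ) ≤ (C * ∫ x, (φ x ^ 2 + ‖fderiv ℝ φ x‖ ^ 2)) ^ χ := by
  have hpow : ∀ (t χ : ℝ), |t| ^ (2 * χ) = (t ^ 2) ^ χ := by
    intro t χ
    rw [Real.rpow_mul (abs_nonneg t)]
    norm_num
  rcases Nat.eq_or_lt_of_le hn with h1 | h2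
  · subst h1
    refine ⟨2, by norm_num, 1, one_pos, fun φ hφ hc => ?_⟩
    set S := ∫ x, (φ x ^ 2 + ‖fderiv ℝ φ x‖ ^ 2) with hS
    have hS0 : 0 ≤ S := integral_nonneg fun x => by positivity
    have hcd : Continuous (fderiv ℝ φ) := hφ.continuous_fderiv one_ne_zero
    have hsq : HasCompactSupport (fun x => φ x ^ 2) :=
      hc.comp_left (g := fun t => t ^ 2) (by simp)
    have hsup : ∀ x, φ x ^ 2 ≤ S := by
      intro x
      have h1 := sup_le_one_dim (fun x => φ x ^ 2) (hφ.pow 2) hsq x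
      have h2 := h1.trans (lintegral_fderiv_sq_le 1 φ hφ hc)
      rw [← ofReal_norm, ENNReal.ofReal_le_ofReal_iff hS0] at h2
      exact (le_abs_self _).trans h2
    have hint1 := integrable_sq 1 hφ.continuous hc
    have hint2 := integrable_fderiv_sq 1 hφ hc
    have hle : ∫ x, φ x ^ 2 ≤ S := by
      apply integral_mono hint1 (hint1.add hint2)
      intro x
      simp
    calc ∫ x, |φ x| ^ (2 * (2:ℝ)) = ∫ x, φ x ^ 2 * φ x ^ 2 := by
          congr 1; ext x; rw [hpow]; norm_num; ring
      _ ≤ ∫ x, S * φ x ^ 2 := by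
          apply integral_mono_of_nonneg (Filter.Eventually.of_forall fun x => by positivity)
            (hint1.const_mul S) (Filter.Eventually.of_forall fun x => ?_)
          exact mul_le_mul_of_nonneg_right (hsup x) (by positivity)
      _ = S * ∫ x, φ x ^ 2 := integral_const_mul _ _
      _ ≤ S * S := mul_le_mul_of_nonneg_left hle hS0
      _ = (1 * S) ^ (2:ℝ) := by norm_num; ring
  · have hn1 : (1:ℝ) < n := by exact_mod_cast h2
    have hp : Real.HolderConjugate (n:ℝ) (Real.conjExponent n) := Real.HolderConjugate.conjExponent hn1
    set χ := Real.conjExponent (n:ℝ) with hχ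
    have hχ1 : 1 < χ := hp.symm.lt
    have hχ0 : 0 < χ := by linarith
    have hp' : Real.HolderConjugate (Module.finrank ℝ (En n) : ℝ) χ := by simpa using hp
    set K := lintegralPowLePowLIntegralFDerivConst (volume : Measure (En n)) χ with hK
    refine ⟨χ, hχ1, ((K : ℝ) + 1) ^ (1 / χ), by positivity, fun φ hφ hc => ?_⟩
    set S := ∫ x, (φ x ^ 2 + ‖fderiv ℝ φ x‖ ^ 2) with hS
    have hS0 : 0 ≤ S := integral_nonneg fun x => by positivity
    have hsq : HasCompactSupport (fun x => φ x ^ 2) :=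
      hc.comp_left (g := fun t => t ^ 2) (by simp)
    have h1 := lintegral_pow_le_pow_lintegral_fderiv (volume : Measure (En n)) (hφ.pow 2) hsq hp'
    have h2 : ∫⁻ x, ‖φ x ^ 2‖ₑ ^ χ ≤ ENNReal.ofReal (((K:ℝ) + 1) * S ^ χ) := by
      refine h1.trans ?_
      rw [ENNReal.ofReal_mul (by positivity), ← ENNReal.ofReal_rpow_of_nonneg hS0 hχ0.le]
      gcongr
      · rw [← hK, ENNReal.le_ofReal_iff_toReal_le (by simp) (by positivity)]
        simp
      · exact lintegral_fderiv_sq_le n φ hφ hc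
    rw [Real.mul_rpow (by positivity) hS0, ← Real.rpow_mul (by positivity), one_div_mul_cancel hχ0.ne',
      Real.rpow_one]
    rw [integral_eq_lintegral_of_nonneg_ae (Filter.Eventually.of_forall fun x => by positivity)]
    · apply ENNReal.toReal_le_of_le_ofReal (by positivity)
      refine le_trans (le_of_eq ?_) h2
      congr 1; ext x
      rw [hpow, ← ofReal_norm, ENNReal.ofReal_rpow_of_nonneg (norm_nonneg _) hχ0.le]
      simp
    · apply Continuous.aestronglyMeasurable
      exact (hφ.continuous.abs).rpow_const (fun x => Or.inr (by positivity))

/-- Cut-off functions. -/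
lemma cutoff (n : ℕ) : ∃ C : ℝ, 1 ≤ C ∧ ∀ r R : ℝ, 0 < r → r < R →
    ∃ η : En n → ℝ, ContDiff ℝ (⊤ : ℕ∞) η ∧ (∀ x, 0 ≤ η x) ∧ (∀ x, η x ≤ 1) ∧
      (∀ x ∈ closedBall (0 : En n) r, η x = 1) ∧ tsupport η ⊆ closedBall 0 R ∧
      ∀ x, ‖fderiv ℝ η x‖ ^ 2 ≤ C / (R - r) ^ 2 := by
  have hsm : ContDiff ℝ 1 smoothTransition := Real.smoothTransition.contDiff (n := 1)
  have hdz : ∀ t : ℝ, t ∉ Set.Icc (0:ℝ) 1 → deriv smoothTransition t = 0 := by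
    intro t ht
    have : smoothTransition =ᶠ[nhds t] fun _ => smoothTransition t := by
      rcases lt_or_ge t 0 with h | h
      · filter_upwards [Iio_mem_nhds h] with s hs
        rw [smoothTransition.zero_of_nonpos (le_of_lt hs), smoothTransition.zero_of_nonpos h.le]
      · have h1 : 1 < t := by
          by_contra h2
          exact ht ⟨h, not_lt.mp h2⟩
        filter_upwards [Ioi_mem_nhds h1] with s hs
        rw [smoothTransition.one_of_one_le (le_of_lt hs), smoothTransition.one_of_one_le h1.le]
    rw [this.deriv_eq]; simp
  obtain ⟨K, hK⟩ : ∃ K, ∀ t, |deriv smoothTransition t| ≤ K := by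
    obtain ⟨K, hK⟩ := (isCompact_Icc (a := (0:ℝ)) (b := 1)).exists_bound_of_continuousOn
      (hsm.continuous_deriv le_rfl).continuousOn
    refine ⟨max K 0, fun t => ?_⟩
    by_cases ht : t ∈ Set.Icc (0:ℝ) 1
    · exact (hK t ht).trans (le_max_left _ _)
    · rw [hdz t ht]; simp
  have hK0 : 0 ≤ K := (abs_nonneg _).trans (hK 0)
  refine ⟨(2 * K + 1) ^ 2, by nlinarith, fun r R hr hrR => ?_⟩
  have hR : 0 < R := hr.trans hrR
  have hd : 0 < R ^ 2 - r ^ 2 := by nlinarith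
  let q : En n → ℝ := fun x => (R ^ 2 - ‖x‖ ^ 2) / (R ^ 2 - r ^ 2)
  have hq : ContDiff ℝ (⊤ : ℕ∞) q := (contDiff_const.sub (contDiff_norm_sq ℝ)).div_const _
  have hη : ContDiff ℝ (⊤ : ℕ∞) (fun x => smoothTransition (q x)) :=
    smoothTransition.contDiff.comp hq
  refine ⟨fun x => smoothTransition (q x), hη, fun x => smoothTransition.nonneg _,
    fun x => smoothTransition.le_one _, ?_, ?_, ?_⟩
  · intro x hx
    apply smoothTransition.one_of_one_le
    rw [mem_closedBall_zero_iff] at hx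
    simp only [q]
    rw [le_div_iff₀ hd]
    nlinarith [norm_nonneg x]
  · apply closure_minimal _ isClosed_closedBall
    intro x hx
    by_contra hx2
    rw [mem_closedBall_zero_iff, not_le] at hx2
    apply hx
    apply smoothTransition.zero_of_nonpos
    apply div_nonpos_of_nonpos_of_nonneg _ hd.le
    nlinarith [norm_nonneg x]
  · intro x
    have hqd : HasFDerivAt q ((-(2 / (R ^ 2 - r ^ 2))) • innerSL ℝ x) x := by
      have h1 := (hasStrictFDerivAt_norm_sq x).hasFDerivAt
      have h2 := (h1.const_sub (R ^ 2)).mul_const ((R ^ 2 - r ^ 2)⁻¹)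
      simp only [q, div_eq_mul_inv]
      convert! h2 using 1
      ext y
      simp
      ring
    have hcd := ((hsm.differentiable one_ne_zero) (q x)).hasDerivAt.comp_hasFDerivAt x hqd
    have hfd : fderiv ℝ (fun x => smoothTransition (q x)) x =
      deriv smoothTransition (q x) • ((-(2 / (R ^ 2 - r ^ 2))) • innerSL ℝ x) := hcd.fderiv
    have hRr : 0 < R - r := by linarith
    have key : ‖fderiv ℝ (fun x => smoothTransition (q x)) x‖ ≤ (2 * K + 1) / (R - r) := by
      rw [hfd, norm_smul, norm_smul, Real.norm_eq_abs, Real.norm_eq_abs, abs_neg,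
        abs_of_pos (show 0 < 2 / (R ^ 2 - r ^ 2) by positivity), innerSL_apply_norm]
      rcases le_or_gt ‖x‖ R with hx | hx
      · have h1 : 2 / (R ^ 2 - r ^ 2) * ‖x‖ ≤ 2 / (R - r) := by
          rw [div_mul_eq_mul_div, div_le_div_iff₀ hd hRr]
          have : R ^ 2 - r ^ 2 = (R - r) * (R + r) := by ring
          rw [this]
          nlinarith
        calc _ ≤ K * (2 / (R - r)) := mul_le_mul (hK _) h1 (by positivity) hK0
          _ ≤ _ := by
            rw [mul_div_assoc']; gcongr; linarith
      · rw [hdz]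
        · simp; positivity
        · intro h
          have := h.1
          simp only [q] at this
          have h2 : (R ^ 2 - ‖x‖ ^ 2) / (R ^ 2 - r ^ 2) < 0 := by
            apply div_neg_of_neg_of_pos _ hd
            nlinarith
          linarith
    calc _ ≤ ((2 * K + 1) / (R - r)) ^ 2 := by gcongr
      _ = _ := by rw [div_pow]

lemma sq_intervalIntegral_le (h : ℝ → ℝ) (hh : Continuous h) :
    (∫ t in (0:ℝ)..1, h t) ^ 2 ≤ ∫ t in (0:ℝ)..1, h t ^ 2 := by
  set c := ∫ t in (0:ℝ)..1, h t with hc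
  have h0 : 0 ≤ ∫ t in (0:ℝ)..1, (h t - c) ^ 2 :=
    intervalIntegral.integral_nonneg zero_le_one fun t _ => sq_nonneg _
  have h1 : ∫ t in (0:ℝ)..1, (h t - c) ^ 2 =
      (∫ t in (0:ℝ)..1, h t ^ 2) - (2 * c) * (∫ t in (0:ℝ)..1, h t) + c ^ 2 := by
    have e : (fun t => (h t - c) ^ 2) = fun t => h t ^ 2 - (2 * c) * h t + c ^ 2 := by
      ext t; ring
    rw [e, intervalIntegral.integral_add, intervalIntegral.integral_sub,
      intervalIntegral.integral_const_mul]
    · simp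
    all_goals exact Continuous.intervalIntegrable (by fun_prop) _ _
  rw [h1, ← hc] at h0
  nlinarith

lemma sq_sub_le_segment (n : ℕ) (w : En n → ℝ) (hw : ContDiff ℝ 1 w) (x y : En n) :
    (w y - w x) ^ 2 ≤
      ‖y - x‖ ^ 2 * ∫ t in (0:ℝ)..1, ‖fderiv ℝ w ((1 - t) • x + t • y)‖ ^ 2 := by
  have hcd : Continuous (fderiv ℝ w) := hw.continuous_fderiv one_ne_zero
  set γ : ℝ → En n := fun t => (1 - t) • x + t • y with hγ
  have hγc : Continuous γ := by fun_prop
  have hγd : ∀ t, HasDerivAt γ (y - x) t := by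
    intro t
    have h1 := (((hasDerivAt_id t).const_sub 1).smul_const x).add ((hasDerivAt_id t).smul_const y)
    convert! h1 using 1
    simp
    abel
  have hd : ∀ t, HasDerivAt (fun t => w (γ t)) (fderiv ℝ w (γ t) (y - x)) t := fun t =>
    ((hw.differentiable one_ne_zero) (γ t)).hasFDerivAt.comp_hasDerivAt t (hγd t)
  have hcont : Continuous (fun t => fderiv ℝ w (γ t) (y - x)) :=
    (hcd.comp hγc).clm_apply continuous_const
  have hF := intervalIntegral.integral_eq_sub_of_hasDerivAt (a := 0) (b := 1)
    (fun t _ => hd t) (hcont.intervalIntegrable _ _)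
  have e1 : γ 1 = y := by simp [hγ]
  have e0 : γ 0 = x := by simp [hγ]
  rw [e1, e0] at hF
  rw [← hF]
  refine (sq_intervalIntegral_le _ hcont).trans ?_
  rw [← intervalIntegral.integral_const_mul]
  apply intervalIntegral.integral_mono_on zero_le_one
  · exact (hcont.pow 2).intervalIntegrable _ _
  · exact (continuous_const.mul ((hcd.comp hγc).norm.pow 2)).intervalIntegrable _ _
  · intro t _
    have := (fderiv ℝ w (γ t)).le_opNorm (y - x)
    rw [← sq_abs, ← Real.norm_eq_abs]
    calc _ ≤ (‖fderiv ℝ w (γ t)‖ * ‖y - x‖) ^ 2 := by gcongr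
      _ = _ := by ring

lemma lintegral_affine_le (n : ℕ) (g : En n → ENNReal) (hg : Measurable g) (t : ℝ)
    (ht : 1 / 2 ≤ t) (x : En n) :
    ∫⁻ y, g (x + t • y) ≤ 2 ^ n * ∫⁻ z, g z := by
  have ht0 : 0 < t := by linarith
  have h1 : ∫⁻ y, g (x + t • y) = ∫⁻ z, g (x + z) ∂(Measure.map (t • ·) volume) := by
    rw [lintegral_map (by fun_prop) (by fun_prop)]
  rw [h1, Measure.map_addHaar_smul _ ht0.ne', lintegral_smul_measure,
    lintegral_add_left_eq_self g x]
  simp only [finrank_euclideanSpace, Fintype.card_fin, smul_eq_mul]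
  gcongr
  rw [abs_of_pos (by positivity)]
  have : ((t ^ n)⁻¹ : ℝ) ≤ 2 ^ n := by
    rw [← inv_pow]
    gcongr
    rw [inv_le_comm₀ ht0 two_pos]
    linarith
  calc _ ≤ ENNReal.ofReal (2 ^ n) := ENNReal.ofReal_le_ofReal this
    _ = 2 ^ n := by rw [ENNReal.ofReal_pow (by norm_num)]; simp

lemma poincare (n : ℕ) : ∃ C : ℝ, 0 < C ∧ ∀ w : En n → ℝ, ContDiff ℝ 1 w → ∀ A : ℝ,
    ∫ x in closedBall (0 : En n) 3, ‖fderiv ℝ w x‖ ^ 2 ≤ A →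
      ∃ c : ℝ, ∫ x in closedBall (0 : En n) 3, (w x - c) ^ 2 ≤ C * A := by
  refine ⟨36 * 2 ^ n, by positivity, fun w hw A hA => ?_⟩
  have hcd : Continuous (fderiv ℝ w) := hw.continuous_fderiv one_ne_zero
  set B := closedBall (0 : En n) 3 with hB
  have hBm : MeasurableSet B := measurableSet_closedBall
  have hBv0 : volume B ≠ 0 := (measure_closedBall_pos volume _ (by norm_num)).ne'
  have hBv1 : volume B ≠ ⊤ := measure_closedBall_lt_top.ne
  set g : En n → ENNReal := B.indicator (fun z => ENNReal.ofReal (‖fderiv ℝ w z‖ ^ 2)) with hgdef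
  have hg : Measurable g := by
    apply Measurable.indicator _ hBm
    exact (ENNReal.continuous_ofReal.comp (hcd.norm.pow 2)).measurable
  have hA0 : 0 ≤ A := le_trans (integral_nonneg fun x => by positivity) hA
  have hgI : ∫⁻ z, g z ≤ ENNReal.ofReal A := by
    rw [hgdef, lintegral_indicator hBm, ← ofReal_integral_eq_lintegral_ofReal]
    · exact ENNReal.ofReal_le_ofReal hA
    · exact (hcd.norm.pow 2).continuousOn.integrableOn_compact (isCompact_closedBall _ _)
    · exact Filter.Eventually.of_forall fun x => by positivity
  have H1 : ∀ x ∈ B, ∀ y ∈ B, ENNReal.ofReal ((w x - w y) ^ 2) ≤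
      36 * ∫⁻ t in Set.Ioc (0:ℝ) 1, g ((1 - t) • x + t • y) := by
    intro x hx y hy
    have h1 := sq_sub_le_segment n w hw x y
    have hxy : ‖y - x‖ ^ 2 ≤ 36 := by
      rw [hB, mem_closedBall_zero_iff] at hx hy
      have := norm_sub_le y x
      nlinarith [norm_nonneg (y - x)]
    have h2 : (w x - w y) ^ 2 ≤ 36 * ∫ t in (0:ℝ)..1, ‖fderiv ℝ w ((1 - t) • x + t • y)‖ ^ 2 := by
      have e : (w x - w y) ^ 2 = (w y - w x) ^ 2 := by ring
      rw [e]
      refine h1.trans (mul_le_mul_of_nonneg_right hxy ?_)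
      exact intervalIntegral.integral_nonneg zero_le_one fun t _ => by positivity
    refine (ENNReal.ofReal_le_ofReal h2).trans ?_
    rw [ENNReal.ofReal_mul (by norm_num), intervalIntegral.integral_of_le zero_le_one,
      ofReal_integral_eq_lintegral_ofReal]
    · have e36 : ENNReal.ofReal 36 = 36 := by simp
      rw [e36]
      gcongr 36 * ?_
      apply setLIntegral_mono' measurableSet_Ioc
      intro t ht
      have hm : (1 - t) • x + t • y ∈ B :=
        (convex_closedBall (0 : En n) 3) hx hy (by linarith [ht.2]) ht.1.le (by ring)
      rw [hgdef, Set.indicator_of_mem hm]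
    · rw [← IntegrableOn, ← intervalIntegrable_iff_integrableOn_Ioc_of_le zero_le_one]
      apply Continuous.intervalIntegrable
      exact (hcd.comp (by fun_prop)).norm.pow 2
    · exact Filter.Eventually.of_forall fun x => by positivity
  have H2 : ∀ t ∈ Set.Ioc (0:ℝ) 1, ∫⁻ y in B, ∫⁻ x in B, g ((1 - t) • x + t • y) ≤
      2 ^ n * ENNReal.ofReal A * volume B := by
    intro t ht
    have hjm : Measurable (fun p : En n × En n => g ((1 - t) • p.2 + t • p.1)) :=
      hg.comp (by fun_prop)
    rcases le_total (1/2) t with h | h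
    · rw [lintegral_lintegral_swap hjm.aemeasurable]
      calc _ ≤ ∫⁻ x in B, 2 ^ n * ENNReal.ofReal A := by
            apply lintegral_mono
            intro x
            refine (lintegral_mono' Measure.restrict_le_self le_rfl).trans ?_
            exact (lintegral_affine_le n g hg t h _).trans (mul_le_mul_right hgI _)
        _ = _ := by simp
    · calc _ ≤ ∫⁻ y in B, 2 ^ n * ENNReal.ofReal A := by
            apply lintegral_mono
            intro y
            refine (lintegral_mono' Measure.restrict_le_self le_rfl).trans ?_
            simp_rw [add_comm ((1 - t) • _) (t • y)]
            exact (lintegral_affine_le n g hg (1 - t) (by linarith) _).trans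
              (mul_le_mul_right hgI _)
        _ = _ := by simp
  have H3 : ∫⁻ y in B, ∫⁻ x in B, ENNReal.ofReal ((w x - w y) ^ 2) ≤
      36 * (2 ^ n * ENNReal.ofReal A * volume B) := by
    have hj3 : Measurable (fun p : (En n × En n) × ℝ => g ((1 - p.2) • p.1.2 + p.2 • p.1.1)) :=
      hg.comp (by fun_prop)
    calc _ ≤ ∫⁻ y in B, ∫⁻ x in B, 36 * ∫⁻ t in Set.Ioc (0:ℝ) 1, g ((1 - t) • x + t • y) := by
          apply setLIntegral_mono' hBm
          intro y hy
          apply setLIntegral_mono' hBm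
          intro x hx
          exact H1 x hx y hy
      _ = 36 * ∫⁻ y in B, ∫⁻ x in B, ∫⁻ t in Set.Ioc (0:ℝ) 1, g ((1 - t) • x + t • y) := by
          rw [← lintegral_const_mul' _ _ (by norm_num)]
          congr 1; ext y
          rw [← lintegral_const_mul' _ _ (by norm_num)]
      _ = 36 * ∫⁻ t in Set.Ioc (0:ℝ) 1, ∫⁻ y in B, ∫⁻ x in B, g ((1 - t) • x + t • y) := by
          congr 1
          have e1 : ∀ y : En n, ∫⁻ x in B, ∫⁻ t in Set.Ioc (0:ℝ) 1, g ((1 - t) • x + t • y) =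
              ∫⁻ t in Set.Ioc (0:ℝ) 1, ∫⁻ x in B, g ((1 - t) • x + t • y) := by
            intro y
            apply lintegral_lintegral_swap
            apply Measurable.aemeasurable
            exact hg.comp (by fun_prop)
          simp_rw [e1]
          apply lintegral_lintegral_swap
          apply Measurable.aemeasurable
          exact Measurable.lintegral_prod_right' (f := fun (q : (En n × ℝ) × En n) =>
            g ((1 - q.1.2) • q.2 + q.1.2 • q.1.1)) (hg.comp (by fun_prop))
      _ ≤ 36 * ∫⁻ t in Set.Ioc (0:ℝ) 1, 2 ^ n * ENNReal.ofReal A * volume B := by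
          gcongr 36 * ?_
          exact setLIntegral_mono' measurableSet_Ioc H2
      _ = _ := by simp
  have hFm : Measurable (fun y => ∫⁻ x in B, ENNReal.ofReal ((w x - w y) ^ 2)) := by
    apply Measurable.lintegral_prod_right' (f := fun (q : En n × En n) =>
              ENNReal.ofReal ((w q.2 - w q.1) ^ 2))
    have := hw.continuous
    apply Continuous.measurable
    exact ENNReal.continuous_ofReal.comp (by fun_prop)
  obtain ⟨y, hy, hyle⟩ := exists_le_setLAverage hBv0 hBv1 hFm.aemeasurable
  refine ⟨w y, ?_⟩
  have hIntg : IntegrableOn (fun x => (w x - w y) ^ 2) B := by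
    have := hw.continuous
    exact ContinuousOn.integrableOn_compact (isCompact_closedBall _ _) (by fun_prop)
  have h5 : ENNReal.ofReal (∫ x in B, (w x - w y) ^ 2) ≤ ENNReal.ofReal (36 * 2 ^ n * A) := by
    rw [ofReal_integral_eq_lintegral_ofReal hIntg (Filter.Eventually.of_forall fun x => by positivity)]
    refine hyle.trans ?_
    rw [setLAverage_eq]
    refine (ENNReal.div_le_div_right H3 _).trans (le_of_eq ?_)
    rw [← mul_assoc, ENNReal.mul_div_cancel_right hBv0 hBv1, ENNReal.ofReal_mul (by positivity),
      ENNReal.ofReal_mul (by positivity), ENNReal.ofReal_pow (by norm_num)]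
    simp [mul_assoc]
  exact (ENNReal.ofReal_le_ofReal_iff (by positivity)).1 h5

/-- Uniform ellipticity. -/
def Ell (n : ℕ) (ε : ℝ) (a : En n → Matrix (Fin n) (Fin n) ℝ) : Prop :=
  (∀ i j, Measurable fun x => a x i j) ∧
  (∀ x, (a x - ε • (1 : Matrix (Fin n) (Fin n) ℝ)).PosSemidef ∧
        ((ε⁻¹ : ℝ) • (1 : Matrix (Fin n) (Fin n) ℝ) - a x).PosSemidef)

/-- `w = log u` with `u` a positive weak solution in `B_{7/2}`. -/
def Sol (n : ℕ) (a : En n → Matrix (Fin n) (Fin n) ℝ) (w : En n → ℝ) : Prop :=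
  ContDiff ℝ 1 w ∧ ∀ ψ : En n → ℝ, ContDiff ℝ 1 ψ → tsupport ψ ⊆ closedBall 0 (7 / 2) →
    ∫ x, exp (w x) * ((a x *ᵥ gradv n w x) ⬝ᵥ gradv n ψ x) = 0

section ell
variable {n : ℕ} {ε : ℝ} {a : En n → Matrix (Fin n) (Fin n) ℝ}

lemma Ell.lower (ha : Ell n ε a) (x : En n) (v : Fin n → ℝ) :
    ε * (v ⬝ᵥ v) ≤ (a x *ᵥ v) ⬝ᵥ v := by
  have := (ha.2 x).1.dotProduct_mulVec_nonneg v
  rw [star_trivial, sub_mulVec, dotProduct_sub, smul_mulVec, one_mulVec, dotProduct_smul,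
    smul_eq_mul, dotProduct_comm v (a x *ᵥ v)] at this
  linarith

lemma Ell.upper (ha : Ell n ε a) (x : En n) (v : Fin n → ℝ) :
    (a x *ᵥ v) ⬝ᵥ v ≤ ε⁻¹ * (v ⬝ᵥ v) := by
  have := (ha.2 x).2.dotProduct_mulVec_nonneg v
  rw [star_trivial, sub_mulVec, dotProduct_sub, smul_mulVec, one_mulVec, dotProduct_smul,
    smul_eq_mul, dotProduct_comm v (a x *ᵥ v)] at this
  linarith

lemma Ell.symm' (ha : Ell n ε a) (x : En n) (v z : Fin n → ℝ) :
    (a x *ᵥ v) ⬝ᵥ z = (a x *ᵥ z) ⬝ᵥ v := by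
  have h1 := (ha.2 x).2.isHermitian
  have h2 : (a x)ᵀ = a x := by
    have h3 : ((ε⁻¹ : ℝ) • (1 : Matrix (Fin n) (Fin n) ℝ) - ((ε⁻¹ : ℝ) • (1 : Matrix (Fin n) (Fin n) ℝ) - a x)).IsHermitian :=
      IsHermitian.sub (by
        rw [IsHermitian, conjTranspose_smul, conjTranspose_one, star_trivial]) h1
    rw [sub_sub_cancel] at h3
    simpa [IsHermitian, conjTranspose_eq_transpose_of_trivial] using h3
  rw [dotProduct_comm, dotProduct_mulVec, ← mulVec_transpose, h2]

lemma Ell.young (ha : Ell n ε a) (hε : 0 < ε) (x : En n) (v z : Fin n → ℝ) (s : ℝ) :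
    2 * s * ((a x *ᵥ v) ⬝ᵥ z) ≤ s ^ 2 * ((a x *ᵥ v) ⬝ᵥ v) + (a x *ᵥ z) ⬝ᵥ z := by
  have h0 : 0 ≤ (a x *ᵥ (s • v - z)) ⬝ᵥ (s • v - z) := by
    refine le_trans ?_ (ha.lower x _)
    have : 0 ≤ (s • v - z) ⬝ᵥ (s • v - z) := dotProduct_self_star_nonneg (s • v - z)
    positivity
  have h1 : (a x *ᵥ (s • v - z)) ⬝ᵥ (s • v - z) =
      s ^ 2 * ((a x *ᵥ v) ⬝ᵥ v) - 2 * s * ((a x *ᵥ v) ⬝ᵥ z) + (a x *ᵥ z) ⬝ᵥ z := by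
    rw [mulVec_sub, mulVec_smul]
    simp only [sub_dotProduct, dotProduct_sub, smul_dotProduct, dotProduct_smul, smul_eq_mul]
    rw [ha.symm' x z v]
    ring
  linarith

lemma Ell.abs_le (ha : Ell n ε a) (hε : 0 < ε) (x : En n) (v z : Fin n → ℝ) (s : ℝ) (hs : 0 < s) :
    |(a x *ᵥ v) ⬝ᵥ z| ≤ ε⁻¹ * (s * (v ⬝ᵥ v) + s⁻¹ * (z ⬝ᵥ z)) := by
  have h1 := ha.young hε x v z s
  have h2 := ha.young hε x v z (-s)
  have h3 := ha.upper x v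
  have h4 := ha.upper x z
  have hv : 0 ≤ v ⬝ᵥ v := dotProduct_self_star_nonneg v
  have hz : 0 ≤ z ⬝ᵥ z := dotProduct_self_star_nonneg z
  have hi : 0 < ε⁻¹ := inv_pos.2 hε
  have h5 : s * |(a x *ᵥ v) ⬝ᵥ z| ≤ ε⁻¹ * (s ^ 2 * (v ⬝ᵥ v) + z ⬝ᵥ z) := by
    have h6 : s ^ 2 * ((a x *ᵥ v) ⬝ᵥ v) ≤ s ^ 2 * (ε⁻¹ * (v ⬝ᵥ v)) := by gcongr
    have h7 : 0 ≤ ε⁻¹ * (s ^ 2 * (v ⬝ᵥ v) + z ⬝ᵥ z) := by positivity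
    rcases abs_cases ((a x *ᵥ v) ⬝ᵥ z) with h | h <;> rw [h.1] <;> nlinarith
  have h8 : ε⁻¹ * (s * (v ⬝ᵥ v) + s⁻¹ * (z ⬝ᵥ z)) = (ε⁻¹ * (s ^ 2 * (v ⬝ᵥ v) + z ⬝ᵥ z)) / s := by
    field_simp
  rw [h8, le_div_iff₀ hs]
  linarith

lemma Ell.measurable (ha : Ell n ε a) {v z : En n → Fin n → ℝ} (hv : Measurable v)
    (hz : Measurable z) : Measurable fun x => (a x *ᵥ v x) ⬝ᵥ z x := by
  simp only [dotProduct, mulVec]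
  have h1 := ha.1
  have h2 : ∀ i, Measurable fun x => v x i := fun i => (measurable_pi_apply i).comp hv
  have h3 : ∀ i, Measurable fun x => z x i := fun i => (measurable_pi_apply i).comp hz
  refine Finset.measurable_sum _ fun i _ => ?_
  refine Measurable.mul (Finset.measurable_sum _ fun j _ => (h1 i j).mul (h2 j)) (h3 i)

end ell

lemma gradv_measurable (n : ℕ) (f : En n → ℝ) : Measurable (gradv n f) := by
  apply measurable_pi_lambda
  intro i
  exact measurable_fderiv_apply_const ℝ f _

lemma gradv_eq_zero {n : ℕ} {f : En n → ℝ} {x : En n} (h : x ∉ tsupport f) : gradv n f x = 0 := by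
  ext i
  simp [gradv, pdrv, fderiv_of_notMem_tsupport ℝ h]

lemma gradv_congr {n : ℕ} {f g : En n → ℝ} {x : En n} (h : fderiv ℝ f x = fderiv ℝ g x) :
    gradv n f x = gradv n g x := by
  ext i
  simp [gradv, pdrv, h]

/-- integrability of the bilinear form integrand -/
lemma Ell.integrableOn {n : ℕ} {ε : ℝ} {a : En n → Matrix (Fin n) (Fin n) ℝ} (ha : Ell n ε a)
    (hε : 0 < ε) (f g : En n → ℝ) (K : Set (En n)) (hK : IsCompact K)
    (hf : ContinuousOn (fderiv ℝ f) K) (hg : ContinuousOn (fderiv ℝ g) K) :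
    IntegrableOn (fun x => (a x *ᵥ gradv n f x) ⬝ᵥ gradv n g x) K := by
  have hb : IntegrableOn (fun x => ε⁻¹ * (‖fderiv ℝ f x‖ ^ 2 + ‖fderiv ℝ g x‖ ^ 2)) K :=
    ContinuousOn.integrableOn_compact hK
      (continuousOn_const.mul ((hf.norm.pow 2).add (hg.norm.pow 2)))
  refine Integrable.mono' hb ?_ ?_
  · exact (ha.measurable (gradv_measurable n f) (gradv_measurable n g)).aestronglyMeasurable
  · refine Filter.Eventually.of_forall fun x => ?_
    have := ha.abs_le hε x (gradv n f x) (gradv n g x) 1 one_pos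
    rw [gradv_dot_self, gradv_dot_self] at this
    simpa using this

/-- C¹ test functions are admissible. -/
lemma test_C1 {n : ℕ} {ε : ℝ} {a : En n → Matrix (Fin n) (Fin n) ℝ} (ha : Ell n ε a)
    (hε : 0 < ε) (f : En n → ℝ) (hf : ContDiffOn ℝ 1 f (ball (0 : En n) 4))
    (hweak : ∀ φ : En n → ℝ, ContDiff ℝ (⊤ : ℕ∞) φ → HasCompactSupport φ →
          tsupport φ ⊆ ball (0 : En n) 4 →
          ∫ x in ball (0 : En n) 4, (a x *ᵥ gradv n f x) ⬝ᵥ gradv n φ x = 0)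
    (ψ : En n → ℝ) (hψ : ContDiff ℝ 1 ψ) (hsupp : tsupport ψ ⊆ closedBall 0 (7 / 2)) :
    ∫ x in ball (0 : En n) 4, (a x *ᵥ gradv n f x) ⬝ᵥ gradv n ψ x = 0 := by
  set K := closedBall (0 : En n) (15 / 4) with hK
  have hKc : IsCompact K := isCompact_closedBall _ _
  have hKsub : K ⊆ ball 0 4 := closedBall_subset_ball (by norm_num)
  have hfc : ContinuousOn (fderiv ℝ f) K :=
    (hf.continuousOn_fderiv_of_isOpen isOpen_ball le_rfl).mono hKsub
  obtain ⟨V, hV⟩ := hKc.exists_bound_of_continuousOn hfc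
  have hψc : HasCompactSupport ψ := HasCompactSupport.of_support_subset_isCompact
    (isCompact_closedBall _ _) ((subset_tsupport ψ).trans hsupp)
  have hdψ : Continuous (fderiv ℝ ψ) := hψ.continuous_fderiv one_ne_zero
  have huc : UniformContinuous (fderiv ℝ ψ) :=
    (hψc.fderiv ℝ).uniformContinuous_of_continuous hdψ
  -- restrict to K
  have hres : ∀ φ : En n → ℝ, tsupport φ ⊆ K →
      ∫ x in ball (0 : En n) 4, (a x *ᵥ gradv n f x) ⬝ᵥ gradv n φ x =
      ∫ x in K, (a x *ᵥ gradv n f x) ⬝ᵥ gradv n φ x := by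
    intro φ hφ
    apply setIntegral_eq_of_subset_of_forall_sdiff_eq_zero measurableSet_ball hKsub
    intro x hx
    rw [gradv_eq_zero (fun h => hx.2 (hφ h)), dotProduct_zero]
  rw [hres ψ (hsupp.trans (closedBall_subset_closedBall (by norm_num)))]
  set I := ∫ x in K, (a x *ᵥ gradv n f x) ⬝ᵥ gradv n ψ x with hI
  have hbound : ∀ c : ℝ, 0 < c → |I| ≤ c * (ε⁻¹ * (V ^ 2 + 1) * volume.real K) := by
    intro c hc
    obtain ⟨δ, hδ, hδc⟩ := Metric.uniformContinuous_iff.1 huc c hc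
    have hr : 0 < min δ (1 / 4) := lt_min hδ (by norm_num)
    let ρ : ContDiffBump (0 : En n) := ⟨min δ (1 / 4) / 2, min δ (1 / 4), by linarith, by linarith⟩
    have hρout : ρ.rOut = min δ (1/4) := rfl
    set φ : En n → ℝ := MeasureTheory.convolution (ρ.normed volume) ψ (ContinuousLinearMap.lsmul ℝ ℝ) volume
      with hφdef
    have hρli : LocallyIntegrable (ρ.normed (volume : Measure (En n))) volume :=
      (ρ.continuous_normed).locallyIntegrable
    have hφs : ContDiff ℝ (⊤ : ℕ∞) φ :=
      HasCompactSupport.contDiff_convolution_left _ ρ.hasCompactSupport_normed ρ.contDiff_normed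
        hψ.continuous.locallyIntegrable
    have hφsupp : tsupport φ ⊆ K := by
      apply closure_minimal _ isClosed_closedBall
      intro x hx
      have := support_convolution_subset _ hx
      obtain ⟨y, hy, z, hz, rfl⟩ := this
      rw [ρ.support_normed_eq, mem_ball_zero_iff, hρout] at hy
      have hz2 := hsupp (subset_tsupport ψ hz)
      rw [mem_closedBall_zero_iff] at hz2
      rw [mem_closedBall_zero_iff]
      beta_reduce
      have := norm_add_le y z
      have := min_le_right δ (1/4)
      linarith
    have hφc : HasCompactSupport φ :=
      HasCompactSupport.of_support_subset_isCompact hKc ((subset_tsupport φ).trans hφsupp)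
    have hz := hweak φ hφs hφc (hφsupp.trans hKsub)
    rw [hres φ hφsupp] at hz
    have hdφ : ∀ x, ‖fderiv ℝ ψ x - fderiv ℝ φ x‖ ≤ c := by
      intro x
      have h1 := (hψc.hasFDerivAt_convolution_right (ContinuousLinearMap.lsmul ℝ ℝ) hρli hψ x).fderiv
      have h2 : (MeasureTheory.convolution (ρ.normed volume) (fderiv ℝ ψ)
          ((ContinuousLinearMap.lsmul ℝ ℝ : ℝ →L[ℝ] ℝ →L[ℝ] ℝ).precompR (En n)) volume) x =
          (MeasureTheory.convolution (ρ.normed volume) (fderiv ℝ ψ)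
          (ContinuousLinearMap.lsmul ℝ ℝ) volume) x := by
        congr 1
      rw [← hφdef, h2] at h1
      have h3 := ContDiffBump.dist_normed_convolution_le (φ := ρ) (μ := (volume : Measure (En n)))
        (g := fderiv ℝ ψ) (x₀ := x) (ε := c) hdψ.aestronglyMeasurable (by
          intro y hy
          rw [mem_ball, hρout] at hy
          exact (hδc (hy.trans_le (min_le_left _ _))).le)
      rw [h1, ← dist_eq_norm, dist_comm]
      exact h3
    have hi1 := ha.integrableOn hε f ψ K hKc hfc hdψ.continuousOn
    have hi2 := ha.integrableOn hε f φ K hKc hfc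
      (hφs.continuous_fderiv (by simp)).continuousOn
    have hsub : I = ∫ x in K, ((a x *ᵥ gradv n f x) ⬝ᵥ gradv n ψ x -
        (a x *ᵥ gradv n f x) ⬝ᵥ gradv n φ x) := by
      rw [integral_sub hi1 hi2, hz, sub_zero]
    rw [hsub]
    have := norm_setIntegral_le_of_norm_le_const (μ := (volume : Measure (En n))) (s := K)
      (f := fun x => ((a x *ᵥ gradv n f x) ⬝ᵥ gradv n ψ x -
        (a x *ᵥ gradv n f x) ⬝ᵥ gradv n φ x)) (C := c * (ε⁻¹ * (V ^ 2 + 1)))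
        hKc.measure_lt_top (by
        intro x hx
        rw [← dotProduct_sub]
        have hg : gradv n ψ x - gradv n φ x = gradv n (fun y => ψ y - φ y) x := by
          ext i
          simp only [gradv, pdrv, Pi.sub_apply]
          rw [fderiv_fun_sub ((hψ.differentiable one_ne_zero) x)
            ((hφs.differentiable (by simp)) x)]
          simp
        have h1 := ha.abs_le hε x (gradv n f x) (gradv n ψ x - gradv n φ x) c hc
        rw [Real.norm_eq_abs]
        refine h1.trans ?_
        rw [hg, gradv_dot_self, gradv_dot_self, fderiv_fun_sub ((hψ.differentiable one_ne_zero) x)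
            ((hφs.differentiable (by simp)) x)]
        have h2 := hdφ x
        have h3 := hV x hx
        have h4 : c⁻¹ * ‖fderiv ℝ ψ x - fderiv ℝ φ x‖ ^ 2 ≤ c := by
          calc _ ≤ c⁻¹ * c ^ 2 := by gcongr
            _ = c := by field_simp
        have h5 : ‖fderiv ℝ f x‖ ^ 2 ≤ V ^ 2 := by gcongr
        calc _ ≤ ε⁻¹ * (c * V ^ 2 + c) := by gcongr
          _ = _ := by ring)
    rw [Real.norm_eq_abs] at this
    calc _ ≤ _ := this
      _ = _ := by ring
  have hI0 : |I| ≤ 0 := by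
    set D := ε⁻¹ * (V ^ 2 + 1) * volume.real K with hD
    have hD0 : 0 ≤ D := by positivity
    by_contra hneg
    push Not at hneg
    have := hbound (|I| / (2 * (D + 1))) (by positivity)
    have h2 : |I| / (2 * (D + 1)) * D ≤ |I| / 2 := by
      rw [div_mul_eq_mul_div, div_le_div_iff₀ (by positivity) (by norm_num)]
      nlinarith
    linarith
  exact abs_nonpos_iff.1 hI0

lemma exists_sol {n : ℕ} {ε : ℝ} {a : En n → Matrix (Fin n) (Fin n) ℝ} (ha : Ell n ε a)
    (hε : 0 < ε) (f : En n → ℝ) (hf : ContDiffOn ℝ 1 f (ball (0 : En n) 4))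
    (hf0 : ∀ x ∈ ball (0 : En n) 4, 0 ≤ f x)
    (hweak : ∀ φ : En n → ℝ, ContDiff ℝ (⊤ : ℕ∞) φ → HasCompactSupport φ →
          tsupport φ ⊆ ball (0 : En n) 4 →
          ∫ x in ball (0 : En n) 4, (a x *ᵥ gradv n f x) ⬝ᵥ gradv n φ x = 0)
    (δ : ℝ) (hδ : 0 < δ) :
    ∃ w, Sol n a w ∧ ∀ x ∈ closedBall (0 : En n) 3, exp (w x) = f x + δ := by
  obtain ⟨D, -, hcut⟩ := cutoff n
  obtain ⟨ζ, hζs, hζ0, -, hζ1, hζsupp, -⟩ := hcut (15 / 4) (31 / 8) (by norm_num) (by norm_num)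
  set u : En n → ℝ := fun x => ζ x * f x + δ with hu
  have hsub : tsupport ζ ⊆ ball 0 4 := hζsupp.trans (closedBall_subset_ball (by norm_num))
  have hprod : ContDiff ℝ 1 (fun x => ζ x * f x) := by
    rw [contDiff_iff_contDiffAt]
    intro x
    by_cases hx : x ∈ ball (0 : En n) 4
    · exact ((hζs.of_le (by exact_mod_cast le_top)).contDiffAt).mul
        (hf.contDiffAt (isOpen_ball.mem_nhds hx))
    · have h1 : x ∉ tsupport ζ := fun h => hx (hsub h)
      rw [notMem_tsupport_iff_eventuallyEq] at h1
      apply ContDiffAt.congr_of_eventuallyEq (f := fun _ => (0:ℝ)) contDiffAt_const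
      filter_upwards [h1] with y hy
      simp [hy]
  have hus : ContDiff ℝ 1 u := hprod.add contDiff_const
  have hupos : ∀ x, 0 < u x := by
    intro x
    by_cases hx : x ∈ ball (0 : En n) 4
    · have := mul_nonneg (hζ0 x) (hf0 x hx)
      simp only [hu]; linarith
    · have h1 : ζ x = 0 := image_eq_zero_of_notMem_tsupport (fun h => hx (hsub h))
      simp [hu, h1, hδ]
  have hueq : ∀ x ∈ closedBall (0 : En n) (15 / 4), u x = f x + δ := by
    intro x hx
    simp [hu, hζ1 x hx]
  refine ⟨fun x => log (u x), ⟨hus.log fun x => (hupos x).ne', ?_⟩, ?_⟩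
  · intro ψ hψ hsupp
    rw [← test_C1 ha hε f hf hweak ψ hψ hsupp]
    have hz : ∀ x, x ∉ ball (0 : En n) 4 →
        exp (log (u x)) * ((a x *ᵥ gradv n (fun x => log (u x)) x) ⬝ᵥ gradv n ψ x) = 0 := by
      intro x hx
      rw [gradv_eq_zero (f := ψ), dotProduct_zero, mul_zero]
      intro h
      exact hx (closedBall_subset_ball (by norm_num) (hsupp h))
    rw [← setIntegral_eq_integral_of_forall_compl_eq_zero hz]
    apply setIntegral_congr_fun measurableSet_ball
    intro x hx
    beta_reduce
    by_cases hxt : x ∈ tsupport ψ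
    · have hx2 : x ∈ ball (0 : En n) (15/4) := closedBall_subset_ball (by norm_num) (hsupp hxt)
      have hev : u =ᶠ[nhds x] fun y => f y + δ := by
        filter_upwards [isOpen_ball.mem_nhds hx2] with y hy
        exact hueq y (ball_subset_closedBall hy)
      have hfd : fderiv ℝ u x = fderiv ℝ f x := by
        rw [hev.fderiv_eq, fderiv_add_const]
      have hlog : fderiv ℝ (fun x => log (u x)) x = (u x)⁻¹ • fderiv ℝ f x := by
        rw [fderiv.log ((hus.differentiable one_ne_zero) x) (hupos x).ne', hfd]
      have hg : gradv n (fun x => log (u x)) x = (u x)⁻¹ • gradv n f x := by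
        ext i
        simp [gradv, pdrv, hlog]
      rw [hg, mulVec_smul, smul_dotProduct, smul_eq_mul, exp_log (hupos x), ← mul_assoc,
        mul_inv_cancel₀ (hupos x).ne', one_mul]
    · simp [gradv_eq_zero hxt]
  · intro x hx
    rw [exp_log (hupos x), hueq x (closedBall_subset_closedBall (by norm_num) hx)]

lemma Sol.sub_const {n : ℕ} {a : En n → Matrix (Fin n) (Fin n) ℝ} {w : En n → ℝ}
    (hw : Sol n a w) (c : ℝ) : Sol n a (fun x => w x - c) := by
  refine ⟨hw.1.sub contDiff_const, fun ψ hψ hs => ?_⟩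
  have h := hw.2 ψ hψ hs
  have e : ∀ x, exp (w x - c) * ((a x *ᵥ gradv n (fun x => w x - c) x) ⬝ᵥ gradv n ψ x) =
      exp (-c) * (exp (w x) * ((a x *ᵥ gradv n w x) ⬝ᵥ gradv n ψ x)) := by
    intro x
    rw [gradv_congr (f := fun x => w x - c) (g := w) (by rw [fderiv_sub_const])]
    rw [sub_eq_add_neg, exp_add]
    ring
  simp_rw [e]
  rw [integral_const_mul, h, mul_zero]

lemma hasCompactSupport_of_closedBall {n : ℕ} {η : En n → ℝ} {R : ℝ}
    (h : tsupport η ⊆ closedBall 0 R) : HasCompactSupport η :=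
  HasCompactSupport.of_support_subset_isCompact
    (isCompact_closedBall _ _) ((subset_tsupport η).trans h)

lemma caccioppoli {n : ℕ} {ε : ℝ} {a : En n → Matrix (Fin n) (Fin n) ℝ} (ha : Ell n ε a)
    (hε : 0 < ε) {w : En n → ℝ} (hw : Sol n a w) (G : ℝ → ℝ) (hG : ContDiff ℝ 1 G)
    (hG0 : ∀ t, 0 ≤ G t) (c₀ : ℝ) (hc₀ : 0 < c₀)
    (hGd : (∀ t, c₀ * G t ≤ deriv G t - G t) ∨ (∀ t, c₀ * G t ≤ G t - deriv G t))
    (η : En n → ℝ) (hη : ContDiff ℝ 1 η) (hsupp : tsupport η ⊆ closedBall 0 (7 / 2)) :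
    ∫ x, η x ^ 2 * G (w x) * ‖fderiv ℝ w x‖ ^ 2 ≤
      4 / (c₀ ^ 2 * ε ^ 2) * ∫ x, G (w x) * ‖fderiv ℝ η x‖ ^ 2 := by
  obtain ⟨hw1, hw2⟩ := hw
  have hηc : HasCompactSupport η := hasCompactSupport_of_closedBall hsupp
  have hwd : ∀ x, HasFDerivAt w (fderiv ℝ w x) x := fun x =>
    ((hw1.differentiable one_ne_zero) x).hasFDerivAt
  have hηd : ∀ x, HasFDerivAt η (fderiv ℝ η x) x := fun x =>
    ((hη.differentiable one_ne_zero) x).hasFDerivAt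
  have hGdd : ∀ t, HasDerivAt G (deriv G t) t := fun t =>
    ((hG.differentiable one_ne_zero) t).hasDerivAt
  have hcw : Continuous (fderiv ℝ w) := hw1.continuous_fderiv one_ne_zero
  have hcη : Continuous (fderiv ℝ η) := hη.continuous_fderiv one_ne_zero
  set ψ : En n → ℝ := fun x => η x ^ 2 * (G (w x) * exp (-w x)) with hψdef
  have hψ : ContDiff ℝ 1 ψ := (hη.pow 2).mul ((hG.comp hw1).mul (hw1.neg.exp))
  have hψsupp : tsupport ψ ⊆ closedBall 0 (7 / 2) := by
    refine Set.Subset.trans ?_ hsupp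
    apply closure_mono
    intro x hx
    rw [Function.mem_support] at hx ⊢
    intro h
    apply hx
    simp [hψdef, h]
  have hψgrad : ∀ x, gradv n ψ x = exp (-w x) • ((2 * η x * G (w x)) • gradv n η x +
      (η x ^ 2 * (deriv G (w x) - G (w x))) • gradv n w x) := by
    intro x
    have h1 : HasFDerivAt ψ _ x := ((hηd x).pow 2).mul
      (((hGdd (w x)).comp_hasFDerivAt x (hwd x)).mul ((hwd x).neg.exp))
    ext i
    simp only [gradv, pdrv]
    rw [h1.fderiv]
    simp [gradv, pdrv]
    ring
  set P : En n → ℝ := fun x => (a x *ᵥ gradv n w x) ⬝ᵥ gradv n η x with hP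
  set Q : En n → ℝ := fun x => (a x *ᵥ gradv n w x) ⬝ᵥ gradv n w x with hQ
  have hIntg : ∀ x, exp (w x) * ((a x *ᵥ gradv n w x) ⬝ᵥ gradv n ψ x) =
      2 * η x * G (w x) * P x + η x ^ 2 * (deriv G (w x) - G (w x)) * Q x := by
    intro x
    rw [hψgrad x, dotProduct_smul, smul_eq_mul, ← mul_assoc, ← exp_add, add_neg_cancel, exp_zero,
      one_mul, dotProduct_add, dotProduct_smul, dotProduct_smul, smul_eq_mul, smul_eq_mul]
  have hzero := hw2 ψ hψ hψsupp
  have hI : Integrable (fun x => exp (w x) * ((a x *ᵥ gradv n w x) ⬝ᵥ gradv n ψ x)) := by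
    have h1 := ha.integrableOn hε w ψ _ (isCompact_closedBall (0 : En n) (7/2)) hcw.continuousOn
      (hψ.continuous_fderiv one_ne_zero).continuousOn
    have h2 : IntegrableOn (fun x => exp (w x) * ((a x *ᵥ gradv n w x) ⬝ᵥ gradv n ψ x))
        (closedBall (0 : En n) (7/2)) := by
      exact h1.continuousOn_mul (hw1.continuous.rexp.continuousOn) (isCompact_closedBall _ _)
    rw [← integrableOn_iff_integrable_of_support_subset (s := closedBall (0 : En n) (7/2))]
    · exact h2
    · intro x hx
      by_contra hx2
      apply hx
      simp [gradv_eq_zero (f := ψ) (fun h => hx2 (hψsupp h))]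
  have hX : Integrable (fun x => η x ^ 2 * G (w x) * ‖fderiv ℝ w x‖ ^ 2) := by
    apply integrable_cs n
    · exact ((hη.continuous.pow 2).mul (hG.continuous.comp hw1.continuous)).mul (hcw.norm.pow 2)
    · refine hηc.mono fun x hx => ?_
      rw [Function.mem_support] at hx ⊢
      intro h
      apply hx; simp [h]
  have hY : Integrable (fun x => G (w x) * ‖fderiv ℝ η x‖ ^ 2) := by
    apply integrable_cs n
    · exact (hG.continuous.comp hw1.continuous).mul (hcη.norm.pow 2)
    · refine (hηc.fderiv ℝ).mono fun x hx => ?_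
      rw [Function.mem_support] at hx ⊢
      intro h
      apply hx; simp [h]
  set X := ∫ x, η x ^ 2 * G (w x) * ‖fderiv ℝ w x‖ ^ 2 with hXdef
  set Y := ∫ x, G (w x) * ‖fderiv ℝ η x‖ ^ 2 with hYdef
  -- pointwise inequality
  have key : ∀ (σ : ℝ), σ ^ 2 = 1 → (∀ t, c₀ * G t ≤ σ * (deriv G t - G t)) →
      (c₀ * ε / 2) * X - (2 / (c₀ * ε)) * Y ≤ 0 := by
    intro σ hσ hσG
    have hle : ∫ x, ((c₀ * ε / 2) * (η x ^ 2 * G (w x) * ‖fderiv ℝ w x‖ ^ 2) -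
        (2 / (c₀ * ε)) * (G (w x) * ‖fderiv ℝ η x‖ ^ 2)) ≤
        ∫ x, σ * (exp (w x) * ((a x *ᵥ gradv n w x) ⬝ᵥ gradv n ψ x)) := by
      apply integral_mono ((hX.const_mul _).sub (hY.const_mul _)) (hI.const_mul _)
      intro x
      simp only [Pi.sub_apply]
      rw [hIntg x]
      have hQl : ε * ‖fderiv ℝ w x‖ ^ 2 ≤ Q x := by
        rw [← gradv_dot_self]; exact ha.lower x _
      have hQ0 : 0 ≤ Q x := le_trans (by positivity) hQl
      have hZ := ha.upper x (gradv n η x)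
      rw [gradv_dot_self] at hZ
      set Z := (a x *ᵥ gradv n η x) ⬝ᵥ gradv n η x with hZdef
      -- young : 2 s P ≤ s² Q + Z with s = - σ c₀ η / 2
      have hy := ha.young hε x (gradv n w x) (gradv n η x) (-(σ * c₀ * η x / 2))
      change 2 * (-(σ * c₀ * η x / 2)) * P x ≤ (-(σ * c₀ * η x / 2)) ^ 2 * Q x + Z at hy
      have e1 : (-(σ * c₀ * η x / 2)) ^ 2 = c₀ ^ 2 * η x ^ 2 / 4 := by
        calc _ = σ ^ 2 * (c₀ ^ 2 * η x ^ 2 / 4) := by ring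
          _ = _ := by rw [hσ, one_mul]
      rw [e1] at hy
      have hGx := hG0 (w x)
      have h1 : c₀ * G (w x) * (η x ^ 2 * Q x) ≤ σ * (deriv G (w x) - G (w x)) * (η x ^ 2 * Q x) :=
        mul_le_mul_of_nonneg_right (hσG (w x)) (by positivity)
      have h2 : -(σ * (2 * η x * G (w x) * P x)) ≤
          c₀ / 2 * (η x ^ 2 * G (w x) * Q x) + 2 / c₀ * (G (w x) * Z) := by
        have := mul_le_mul_of_nonneg_left hy (show 0 ≤ 2 / c₀ * G (w x) by positivity)
        have e2 : 2 / c₀ * G (w x) * (2 * (-(σ * c₀ * η x / 2)) * P x) =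
          -(σ * (2 * η x * G (w x) * P x)) := by field_simp
        have e3 : 2 / c₀ * G (w x) * (c₀ ^ 2 * η x ^ 2 / 4 * Q x + Z) =
          c₀ / 2 * (η x ^ 2 * G (w x) * Q x) + 2 / c₀ * (G (w x) * Z) := by field_simp; ring
        rw [e2, e3] at this
        exact this
      have h3 : 2 / c₀ * (G (w x) * Z) ≤ 2 / (c₀ * ε) * (G (w x) * ‖fderiv ℝ η x‖ ^ 2) := by
        have : 2 / c₀ * (G (w x) * Z) ≤ 2 / c₀ * (G (w x) * (ε⁻¹ * ‖fderiv ℝ η x‖ ^ 2)) := by gcongr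
        refine this.trans (le_of_eq ?_)
        field_simp
      have h4 : c₀ * ε / 2 * (η x ^ 2 * G (w x) * ‖fderiv ℝ w x‖ ^ 2) ≤
          c₀ / 2 * (η x ^ 2 * G (w x) * Q x) := by
        have : c₀ / 2 * (η x ^ 2 * G (w x) * (ε * ‖fderiv ℝ w x‖ ^ 2)) ≤
          c₀ / 2 * (η x ^ 2 * G (w x) * Q x) := by gcongr
        refine le_trans (le_of_eq ?_) this
        ring
      nlinarith
    rw [integral_const_mul, hzero, mul_zero, integral_sub (hX.const_mul _) (hY.const_mul _),
      integral_const_mul, integral_const_mul] at hle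
    exact hle
  have hfin : (c₀ * ε / 2) * X - (2 / (c₀ * ε)) * Y ≤ 0 := by
    rcases hGd with h | h
    · exact key 1 (by norm_num) fun t => by linarith [h t]
    · exact key (-1) (by norm_num) fun t => by linarith [h t]
  have h1 : X ≤ ((2 / (c₀ * ε)) * Y) / (c₀ * ε / 2) := by
    rw [le_div_iff₀ (by positivity)]; linarith
  refine h1.trans (le_of_eq ?_)
  field_simp
  ring

set_option maxHeartbeats 1000000 in
lemma step (n : ℕ) (hn : 1 ≤ n) (ε : ℝ) (hε : 0 < ε) : ∃ χ : ℝ, 1 < χ ∧ ∃ C : ℝ, 1 ≤ C ∧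
    ∀ (a : En n → Matrix (Fin n) (Fin n) ℝ) (w : En n → ℝ), Ell n ε a → Sol n a w →
    ∀ F G : ℝ → ℝ, ContDiff ℝ 1 F → ContDiff ℝ 1 G → ∀ c₀ K : ℝ, 0 < c₀ → 1 ≤ K →
    (∀ t, 0 ≤ G t) →
    ((∀ t, c₀ * G t ≤ deriv G t - G t) ∨ (∀ t, c₀ * G t ≤ G t - deriv G t)) →
    (∀ t, (deriv F t) ^ 2 ≤ c₀ ^ 2 * G t) → (∀ t, G t ≤ K * F t ^ 2) →
    ∀ r R : ℝ, 0 < r → r < R → R ≤ 3 → R - r ≤ 1 →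
    ∫ x in closedBall (0 : En n) r, |F (w x)| ^ (2 * χ) ≤
      (C * K / (R - r) ^ 2 * ∫ x in closedBall (0 : En n) R, F (w x) ^ 2) ^ χ := by
  obtain ⟨χ, hχ, S, hS, hsob⟩ := sobolev n hn
  obtain ⟨D, hD, hcut⟩ := cutoff n
  refine ⟨χ, hχ, S * (1 + 2 * D + 8 / ε ^ 2 * D) + 1, by
    have : 0 ≤ S * (1 + 2 * D + 8 / ε ^ 2 * D) := by positivity
    linarith, ?_⟩
  intro a w ha hw F G hF hG c₀ K hc₀ hK hG0 hGd hFG hGF r R hr hrR hR hRr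
  obtain ⟨η, hηs, hη0, hη1, hηr, hηsupp, hηD⟩ := hcut r R hr hrR
  have hη : ContDiff ℝ 1 η := hηs.of_le (by exact_mod_cast le_top)
  have hw1 := hw.1
  have hηc : HasCompactSupport η := hasCompactSupport_of_closedBall hηsupp
  have hcw : Continuous (fderiv ℝ w) := hw1.continuous_fderiv one_ne_zero
  have hcη : Continuous (fderiv ℝ η) := hη.continuous_fderiv one_ne_zero
  have hFw : ContDiff ℝ 1 (fun x => F (w x)) := hF.comp hw1
  set φ : En n → ℝ := fun x => η x * F (w x) with hφdef
  have hφ : ContDiff ℝ 1 φ := hη.mul hFw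
  have hφc : HasCompactSupport φ := hηc.mul_right
  have hcac := caccioppoli ha hε hw G hG hG0 c₀ hc₀ hGd η hη
    (hηsupp.trans (closedBall_subset_closedBall (by linarith)))
  set J := ∫ x in closedBall (0 : En n) R, F (w x) ^ 2 with hJ
  have hJ0 : 0 ≤ J := integral_nonneg fun x => by positivity
  have hd : 0 < R - r := by linarith
  -- the pieces
  have hi1 : Integrable (fun x => η x ^ 2 * F (w x) ^ 2) := by
    apply integrable_cs n
    · exact (hη.continuous.pow 2).mul (hFw.continuous.pow 2)
    · refine hηc.mono fun x hx => ?_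
      rw [Function.mem_support] at hx ⊢
      intro h
      apply hx; simp [h]
  have hi2 : Integrable (fun x => F (w x) ^ 2 * ‖fderiv ℝ η x‖ ^ 2) := by
    apply integrable_cs n
    · exact (hFw.continuous.pow 2).mul (hcη.norm.pow 2)
    · refine (hηc.fderiv ℝ).mono fun x hx => ?_
      rw [Function.mem_support] at hx ⊢
      intro h
      apply hx; simp [h]
  have hi3 : Integrable (fun x => η x ^ 2 * G (w x) * ‖fderiv ℝ w x‖ ^ 2) := by
    apply integrable_cs n
    · exact ((hη.continuous.pow 2).mul (hG.continuous.comp hw1.continuous)).mul (hcw.norm.pow 2)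
    · refine hηc.mono fun x hx => ?_
      rw [Function.mem_support] at hx ⊢
      intro h
      apply hx; simp [h]
  have hi4 : Integrable (fun x => G (w x) * ‖fderiv ℝ η x‖ ^ 2) := by
    apply integrable_cs n
    · exact (hG.continuous.comp hw1.continuous).mul (hcη.norm.pow 2)
    · refine (hηc.fderiv ℝ).mono fun x hx => ?_
      rw [Function.mem_support] at hx ⊢
      intro h
      apply hx; simp [h]
  have hJi : IntegrableOn (fun x => F (w x) ^ 2) (closedBall (0 : En n) R) :=
    (hFw.continuous.pow 2).continuousOn.integrableOn_compact (isCompact_closedBall _ _)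
  have hb1 : ∫ x, η x ^ 2 * F (w x) ^ 2 ≤ J := by
    rw [← setIntegral_eq_integral_of_forall_compl_eq_zero (s := closedBall (0 : En n) R)]
    · apply integral_mono hi1.integrableOn hJi
      intro x
      have : η x ^ 2 ≤ 1 := pow_le_one₀ (hη0 x) (hη1 x)
      have h2 := sq_nonneg (F (w x))
      beta_reduce
      nlinarith
    · intro x hx
      simp [image_eq_zero_of_notMem_tsupport (fun h => hx (hηsupp h))]
  have hb2 : ∫ x, F (w x) ^ 2 * ‖fderiv ℝ η x‖ ^ 2 ≤ D / (R - r) ^ 2 * J := by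
    rw [← setIntegral_eq_integral_of_forall_compl_eq_zero (s := closedBall (0 : En n) R)]
    · rw [hJ, ← integral_const_mul]
      apply integral_mono hi2.integrableOn (hJi.const_mul _)
      intro x
      beta_reduce
      rw [mul_comm]
      exact mul_le_mul_of_nonneg_right (hηD x) (sq_nonneg _)
    · intro x hx
      simp [fderiv_of_notMem_tsupport ℝ (fun h => hx (hηsupp h))]
  have hb4 : ∫ x, G (w x) * ‖fderiv ℝ η x‖ ^ 2 ≤ K * ∫ x, F (w x) ^ 2 * ‖fderiv ℝ η x‖ ^ 2 := by
    rw [← integral_const_mul]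
    apply integral_mono hi4 (hi2.const_mul _)
    intro x
    beta_reduce
    rw [← mul_assoc]
    exact mul_le_mul_of_nonneg_right (hGF _) (by positivity)
  have hφd : ∀ x, ‖fderiv ℝ φ x‖ ^ 2 ≤ 2 * (F (w x) ^ 2 * ‖fderiv ℝ η x‖ ^ 2) +
      2 * c₀ ^ 2 * (η x ^ 2 * G (w x) * ‖fderiv ℝ w x‖ ^ 2) := by
    intro x
    have hwd := ((hw1.differentiable one_ne_zero) x).hasFDerivAt
    have hηd := ((hη.differentiable one_ne_zero) x).hasFDerivAt
    have hFd := ((hF.differentiable one_ne_zero) (w x)).hasDerivAt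
    have h1 : fderiv ℝ φ x = η x • (deriv F (w x) • fderiv ℝ w x) + F (w x) • fderiv ℝ η x :=
      (hηd.mul (hFd.comp_hasFDerivAt x hwd)).fderiv
    have h2 : ‖fderiv ℝ φ x‖ ≤ |η x| * (|deriv F (w x)| * ‖fderiv ℝ w x‖) +
        |F (w x)| * ‖fderiv ℝ η x‖ := by
      rw [h1]
      refine (norm_add_le _ _).trans (le_of_eq ?_)
      rw [norm_smul, norm_smul, norm_smul]
      simp
    have h3 : ‖fderiv ℝ φ x‖ ^ 2 ≤ 2 * (|η x| * (|deriv F (w x)| * ‖fderiv ℝ w x‖)) ^ 2 +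
        2 * (|F (w x)| * ‖fderiv ℝ η x‖) ^ 2 := by
      have h4 : ‖fderiv ℝ φ x‖ ^ 2 ≤ (|η x| * (|deriv F (w x)| * ‖fderiv ℝ w x‖) +
        |F (w x)| * ‖fderiv ℝ η x‖) ^ 2 := by gcongr
      nlinarith [sq_nonneg (|η x| * (|deriv F (w x)| * ‖fderiv ℝ w x‖) -
        |F (w x)| * ‖fderiv ℝ η x‖)]
    have h5 : (|η x| * (|deriv F (w x)| * ‖fderiv ℝ w x‖)) ^ 2 =
        deriv F (w x) ^ 2 * (η x ^ 2 * ‖fderiv ℝ w x‖ ^ 2) := by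
      rw [mul_pow, mul_pow, sq_abs, sq_abs]; ring
    have h6 : (|F (w x)| * ‖fderiv ℝ η x‖) ^ 2 = F (w x) ^ 2 * ‖fderiv ℝ η x‖ ^ 2 := by
      rw [mul_pow, sq_abs]
    have h7 : deriv F (w x) ^ 2 * (η x ^ 2 * ‖fderiv ℝ w x‖ ^ 2) ≤
        c₀ ^ 2 * G (w x) * (η x ^ 2 * ‖fderiv ℝ w x‖ ^ 2) :=
      mul_le_mul_of_nonneg_right (hFG _) (by positivity)
    rw [h5, h6] at h3
    nlinarith
  have hE : ∫ x, (φ x ^ 2 + ‖fderiv ℝ φ x‖ ^ 2) ≤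
      (1 + 2 * D + 8 / ε ^ 2 * D) * K / (R - r) ^ 2 * J := by
    have h1 : ∫ x, (φ x ^ 2 + ‖fderiv ℝ φ x‖ ^ 2) ≤ ∫ x, (η x ^ 2 * F (w x) ^ 2 +
        (2 * (F (w x) ^ 2 * ‖fderiv ℝ η x‖ ^ 2) +
      2 * c₀ ^ 2 * (η x ^ 2 * G (w x) * ‖fderiv ℝ w x‖ ^ 2))) := by
      apply integral_mono ((integrable_sq n hφ.continuous hφc).add (integrable_fderiv_sq n hφ hφc))
        (hi1.add ((hi2.const_mul _).add (hi3.const_mul _)))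
      intro x
      have e : φ x ^ 2 = η x ^ 2 * F (w x) ^ 2 := by simp only [hφdef]; ring
      simp only [Pi.add_apply]
      rw [e]
      have := hφd x
      linarith
    have e2 : ∫ x, (η x ^ 2 * F (w x) ^ 2 +
        (2 * (F (w x) ^ 2 * ‖fderiv ℝ η x‖ ^ 2) +
      2 * c₀ ^ 2 * (η x ^ 2 * G (w x) * ‖fderiv ℝ w x‖ ^ 2))) =
      (∫ x, η x ^ 2 * F (w x) ^ 2) + (2 * (∫ x, F (w x) ^ 2 * ‖fderiv ℝ η x‖ ^ 2) +
      2 * c₀ ^ 2 * (∫ x, η x ^ 2 * G (w x) * ‖fderiv ℝ w x‖ ^ 2)) := by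
      have hsum : Integrable (fun x => 2 * (F (w x) ^ 2 * ‖fderiv ℝ η x‖ ^ 2) +
          2 * c₀ ^ 2 * (η x ^ 2 * G (w x) * ‖fderiv ℝ w x‖ ^ 2)) :=
        (hi2.const_mul _).add (hi3.const_mul _)
      rw [integral_add hi1 hsum,
        integral_add (hi2.const_mul _) (hi3.const_mul _), integral_const_mul, integral_const_mul]
    rw [e2] at h1
    set Y := ∫ x, F (w x) ^ 2 * ‖fderiv ℝ η x‖ ^ 2 with hY
    have h3 : 2 * c₀ ^ 2 * (∫ x, η x ^ 2 * G (w x) * ‖fderiv ℝ w x‖ ^ 2) ≤ 8 / ε ^ 2 * (K * Y) := by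
      calc _ ≤ 2 * c₀ ^ 2 * (4 / (c₀ ^ 2 * ε ^ 2) * (K * Y)) := by
            gcongr
            exact hcac.trans (by gcongr)
        _ = _ := by field_simp; ring
    set q := 1 / (R - r) ^ 2 with hq
    have hq1 : 1 ≤ q := by
      rw [hq, le_div_iff₀ (by positivity), one_mul]
      exact pow_le_one₀ hd.le hRr
    have hYq : Y ≤ D * q * J := by
      refine hb2.trans (le_of_eq ?_)
      rw [hq]; ring
    have h8 : 0 ≤ 8 / ε ^ 2 := by positivity
    have h9 : 8 / ε ^ 2 * (K * Y) ≤ 8 / ε ^ 2 * (K * (D * q * J)) := by gcongr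
    have e5 : (1 + 2 * D + 8 / ε ^ 2 * D) * K / (R - r) ^ 2 * J =
      K * q * J + 2 * (K * (D * q * J)) + 8 / ε ^ 2 * (K * (D * q * J)) := by rw [hq]; ring
    rw [e5]
    have h10 : J ≤ K * q * J := by
      exact le_mul_of_one_le_left hJ0 (one_le_mul_of_one_le_of_one_le hK hq1)
    have h11 : D * q * J ≤ K * (D * q * J) := by
      exact le_mul_of_one_le_left (by positivity) hK
    linarith
  have hIntg : Integrable (fun x => |φ x| ^ (2 * χ)) := by
    apply integrable_cs n
    · exact (hφ.continuous.abs).rpow_const (fun x => Or.inr (by linarith))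
    · refine hφc.mono fun x hx => ?_
      rw [Function.mem_support] at hx ⊢
      intro h
      apply hx
      rw [h, abs_zero, Real.zero_rpow (by linarith)]
  calc ∫ x in closedBall (0 : En n) r, |F (w x)| ^ (2 * χ)
      = ∫ x in closedBall (0 : En n) r, |φ x| ^ (2 * χ) := by
        apply setIntegral_congr_fun measurableSet_closedBall
        intro x hx
        simp only [hφdef, hηr x hx, one_mul]
    _ ≤ ∫ x, |φ x| ^ (2 * χ) :=
        setIntegral_le_integral hIntg (Filter.Eventually.of_forall fun x => by positivity)
    _ ≤ (S * ∫ x, (φ x ^ 2 + ‖fderiv ℝ φ x‖ ^ 2)) ^ χ := hsob φ hφ hφc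
    _ ≤ _ := by
        have h0 : 0 ≤ ∫ x, (φ x ^ 2 + ‖fderiv ℝ φ x‖ ^ 2) := integral_nonneg fun x => by positivity
        apply Real.rpow_le_rpow (by positivity) _ (by linarith)
        calc _ ≤ S * ((1 + 2 * D + 8 / ε ^ 2 * D) * K / (R - r) ^ 2 * J) := by gcongr
          _ = (S * (1 + 2 * D + 8 / ε ^ 2 * D)) * K / (R - r) ^ 2 * J := by ring
          _ ≤ _ := by
            gcongr
            linarith

lemma log_estimate (n : ℕ) (ε : ℝ) (hε : 0 < ε) : ∃ A : ℝ, 0 ≤ A ∧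
    ∀ (a : En n → Matrix (Fin n) (Fin n) ℝ) (w : En n → ℝ), Ell n ε a → Sol n a w →
    ∃ c, ∫ x in closedBall (0 : En n) 3, (w x - c) ^ 2 ≤ A := by
  obtain ⟨D, hD, hcut⟩ := cutoff n
  obtain ⟨Q, hQ, hpoin⟩ := poincare n
  obtain ⟨η, hηs, hη0, hη1, hηr, hηsupp, hηD⟩ := hcut 3 (7 / 2) (by norm_num) (by norm_num)
  have hη : ContDiff ℝ 1 η := hηs.of_le (by exact_mod_cast le_top)
  have hηc : HasCompactSupport η := hasCompactSupport_of_closedBall hηsupp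
  set Y := ∫ x, (1 : ℝ) * ‖fderiv ℝ η x‖ ^ 2 with hY
  have hY0 : 0 ≤ Y := integral_nonneg fun x => by positivity
  refine ⟨Q * (4 / (1 ^ 2 * ε ^ 2) * Y), by positivity, ?_⟩
  intro a w ha hw
  have hcw : Continuous (fderiv ℝ w) := hw.1.continuous_fderiv one_ne_zero
  have hcac := caccioppoli ha hε hw (fun _ => 1) contDiff_const (fun _ => zero_le_one) 1 one_pos
    (Or.inr fun t => by simp) η hη hηsupp
  apply hpoin w hw.1
  refine le_trans ?_ hcac
  have hi : Integrable (fun x => η x ^ 2 * 1 * ‖fderiv ℝ w x‖ ^ 2) := by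
    apply integrable_cs n
    · exact ((hη.continuous.pow 2).mul continuous_const).mul (hcw.norm.pow 2)
    · refine hηc.mono fun x hx => ?_
      rw [Function.mem_support] at hx ⊢
      intro h
      apply hx; simp [h]
  refine le_trans (le_of_eq ?_) (setIntegral_le_integral (s := closedBall (0 : En n) 3) hi
    (Filter.Eventually.of_forall fun x => by positivity))
  apply setIntegral_congr_fun measurableSet_closedBall
  intro x hx
  simp [hηr x hx]

/-- The Moser step inequality for a fixed function. -/
def StepW (n : ℕ) (χ C : ℝ) (w : En n → ℝ) : Prop :=
    ∀ F G : ℝ → ℝ, ContDiff ℝ 1 F → ContDiff ℝ 1 G → ∀ c₀ K : ℝ, 0 < c₀ → 1 ≤ K →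
    (∀ t, 0 ≤ G t) →
    ((∀ t, c₀ * G t ≤ deriv G t - G t) ∨ (∀ t, c₀ * G t ≤ G t - deriv G t)) →
    (∀ t, (deriv F t) ^ 2 ≤ c₀ ^ 2 * G t) → (∀ t, G t ≤ K * F t ^ 2) →
    ∀ r R : ℝ, 0 < r → r < R → R ≤ 3 → R - r ≤ 1 →
    ∫ x in closedBall (0 : En n) r, |F (w x)| ^ (2 * χ) ≤
      (C * K / (R - r) ^ 2 * ∫ x in closedBall (0 : En n) R, F (w x) ^ 2) ^ χ

lemma moment_step {n : ℕ} {χ C : ℝ} {w : En n → ℝ} (hs : StepW n χ C w) (p k : ℝ)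
    (hp : 1 ≤ p) (hk : 2 * p ≤ k) (r R : ℝ) (hr : 0 < r) (hrR : r < R) (hR : R ≤ 3)
    (hRr : R - r ≤ 1) :
    ∫ x in closedBall (0 : En n) r, (k ^ 2 + w x ^ 2) ^ (p * χ) ≤
      (C * (4 * p ^ 2) / (R - r) ^ 2 *
        ∫ x in closedBall (0 : En n) R, (k ^ 2 + w x ^ 2) ^ p) ^ χ := by
  have hq : ∀ t : ℝ, 1 ≤ k ^ 2 + t ^ 2 := fun t => by nlinarith [sq_nonneg t]
  have hq0 : ∀ t : ℝ, 0 < k ^ 2 + t ^ 2 := fun t => lt_of_lt_of_le one_pos (hq t)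
  have hqd : ∀ t : ℝ, HasDerivAt (fun t : ℝ => k ^ 2 + t ^ 2) (2 * t) t := fun t => by
    simpa using ((hasDerivAt_id t).pow 2).const_add (k ^ 2)
  have hqs : ContDiff ℝ 1 (fun t : ℝ => k ^ 2 + t ^ 2) := by fun_prop
  set F : ℝ → ℝ := fun t => (k ^ 2 + t ^ 2) ^ (p / 2) with hF
  set G : ℝ → ℝ := fun t => 4 * p ^ 2 * (k ^ 2 + t ^ 2) ^ (p - 1) with hG
  have hFd : ∀ t, deriv F t = 2 * t * (p / 2) * (k ^ 2 + t ^ 2) ^ (p / 2 - 1) := fun t =>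
    ((hqd t).rpow_const (Or.inl (hq0 t).ne')).deriv
  have hGd : ∀ t, deriv G t = 4 * p ^ 2 * (2 * t * (p - 1) * (k ^ 2 + t ^ 2) ^ (p - 1 - 1)) :=
    fun t => (((hqd t).rpow_const (Or.inl (hq0 t).ne')).const_mul (4 * p ^ 2)).deriv
  have e1 : ∀ t : ℝ, (k ^ 2 + t ^ 2) ^ (p - 1) =
      (k ^ 2 + t ^ 2) ^ (p - 1 - 1) * (k ^ 2 + t ^ 2) := fun t => by
    rw [Real.rpow_sub_one (hq0 t).ne' (p - 1), div_mul_cancel₀ _ (hq0 t).ne']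
  have hF2 : ∀ t, F t ^ 2 = (k ^ 2 + t ^ 2) ^ p := fun t => by
    simp only [hF]
    rw [← Real.rpow_natCast, ← Real.rpow_mul (hq0 t).le]
    norm_num
  have hF3 : ∀ t, |F t| ^ (2 * χ) = (k ^ 2 + t ^ 2) ^ (p * χ) := fun t => by
    simp only [hF]
    rw [abs_of_pos (Real.rpow_pos_of_pos (hq0 t) _), ← Real.rpow_mul (hq0 t).le]
    congr 1; ring
  have h := hs F G (hqs.rpow_const_of_ne fun t => (hq0 t).ne')
    (contDiff_const.mul (hqs.rpow_const_of_ne fun t => (hq0 t).ne')) (1 / 2) (4 * p ^ 2)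
    (by norm_num) (by nlinarith) (fun t => by
      have := Real.rpow_pos_of_pos (hq0 t) (p - 1)
      simp only [hG]; positivity)
    (Or.inr fun t => by
      rw [hGd]
      simp only [hG]
      rw [e1]
      have h0 := Real.rpow_pos_of_pos (hq0 t) (p - 1 - 1)
      set z := (k ^ 2 + t ^ 2) ^ (p - 1 - 1)
      have h2 : 4 * (t * (p - 1)) ≤ k ^ 2 + t ^ 2 := by
        nlinarith [sq_nonneg (t - 2 * (p - 1)), sq_nonneg (k - 2 * p)]
      have h3 : 0 ≤ 2 * p ^ 2 * z * (k ^ 2 + t ^ 2 - 4 * (t * (p - 1))) :=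
        mul_nonneg (by positivity) (by linarith)
      linarith)
    (fun t => by
      rw [hFd]
      simp only [hG]
      rw [e1]
      have h0 := Real.rpow_pos_of_pos (hq0 t) (p - 1 - 1)
      have e2 : ((k ^ 2 + t ^ 2) ^ (p / 2 - 1)) ^ 2 = (k ^ 2 + t ^ 2) ^ (p - 1 - 1) := by
        rw [← Real.rpow_natCast, ← Real.rpow_mul (hq0 t).le]
        congr 1; push_cast; ring
      rw [mul_pow, e2]
      set z := (k ^ 2 + t ^ 2) ^ (p - 1 - 1)
      have : 0 ≤ p ^ 2 * z * k ^ 2 := by positivity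
      linarith)
    (fun t => by
      rw [hF2]
      simp only [hG]
      gcongr
      · exact hq t
      · linarith)
    r R hr hrR hR hRr
  simp only [hF2, hF3] at h
  exact h

lemma moments (n : ℕ) (χ C : ℝ) (hχ : 1 < χ) (hC : 1 ≤ C) (m : ℕ) (A : ℝ) :
    ∃ k P : ℝ, 1 ≤ k ∧ 0 ≤ P ∧ ∀ w : En n → ℝ, Continuous w → StepW n χ C w →
      ∫ x in closedBall (0 : En n) 3, w x ^ 2 ≤ A →
      ∫ x in closedBall (0 : En n) 2, (k ^ 2 + w x ^ 2) ^ m ≤ P := by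
  obtain ⟨N, hN⟩ := pow_unbounded_of_one_lt (m : ℝ) hχ
  set k := 2 * χ ^ N with hk
  have hN1 : 1 ≤ χ ^ N := one_le_pow₀ hχ.le
  have hk1 : 1 ≤ k := by linarith
  have hq : ∀ t : ℝ, 1 ≤ k ^ 2 + t ^ 2 := fun t => by nlinarith [sq_nonneg t]
  have hcont : ∀ (w : En n → ℝ) (p : ℝ), Continuous w →
      Continuous fun x => (k ^ 2 + w x ^ 2) ^ p := fun w p hw =>
    (continuous_const.add (hw.pow 2)).rpow_const
      fun x => Or.inl (lt_of_lt_of_le one_pos (hq _)).ne'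
  have main : ∀ j : ℕ, j ≤ N → ∃ P : ℝ, 0 ≤ P ∧ ∀ w : En n → ℝ, Continuous w → StepW n χ C w →
      ∫ x in closedBall (0 : En n) 3, w x ^ 2 ≤ A →
      ∫ x in closedBall (0 : En n) (2 + (1 / 2) ^ j), (k ^ 2 + w x ^ 2) ^ (χ ^ j) ≤ P := by
    intro j
    induction j with
    | zero =>
      intro _
      refine ⟨|(∫ x in closedBall (0 : En n) 3, k ^ 2) + A|, abs_nonneg _, fun w hw hs hA => ?_⟩
      norm_num
      refine le_trans ?_ (le_abs_self _)
      rw [integral_add]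
      · simpa using hA
      · exact continuous_const.continuousOn.integrableOn_compact (isCompact_closedBall _ _)
      · exact (hw.pow 2).continuousOn.integrableOn_compact (isCompact_closedBall _ _)
    | succ j ih =>
      intro hj
      obtain ⟨P, hP, h⟩ := ih (by omega)
      have hp : 1 ≤ χ ^ j := one_le_pow₀ hχ.le
      have hpk : 2 * χ ^ j ≤ k := by
        rw [hk]
        have : χ ^ j ≤ χ ^ N := pow_le_pow_right₀ hχ.le (by omega)
        linarith
      have h2 : (0:ℝ) < (1 / 2) ^ j := by positivity
      have h3 : ((1:ℝ) / 2) ^ j ≤ 1 := pow_le_one₀ (by norm_num) (by norm_num)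
      have h4 : ((1:ℝ) / 2) ^ (j + 1) = (1 / 2) ^ j / 2 := by rw [pow_succ]; ring
      refine ⟨(C * (4 * (χ ^ j) ^ 2) / ((1 / 2) ^ j / 2) ^ 2 * P) ^ χ, by positivity,
        fun w hw hs hA => ?_⟩
      have h5 := moment_step hs (χ ^ j) k hp hpk (2 + (1 / 2) ^ (j + 1)) (2 + (1 / 2) ^ j)
        (by positivity) (by rw [h4]; linarith) (by linarith) (by rw [h4]; linarith)
      rw [← pow_succ] at h5
      refine h5.trans ?_
      have h6 : 2 + ((1:ℝ) / 2) ^ j - (2 + (1 / 2) ^ (j + 1)) = (1 / 2) ^ j / 2 := by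
        rw [h4]; ring
      rw [h6]
      have h7 := h w hw hs hA
      have h8 : 0 ≤ ∫ x in closedBall (0 : En n) (2 + (1 / 2) ^ j), (k ^ 2 + w x ^ 2) ^ (χ ^ j) :=
        integral_nonneg fun x => Real.rpow_nonneg (by positivity) _
      apply Real.rpow_le_rpow (by positivity) _ (by linarith)
      gcongr
  obtain ⟨P, hP, h⟩ := main N le_rfl
  refine ⟨k, P, hk1, hP, fun w hw hs hA => le_trans ?_ (h w hw hs hA)⟩
  calc ∫ x in closedBall (0 : En n) 2, (k ^ 2 + w x ^ 2) ^ m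
      ≤ ∫ x in closedBall (0 : En n) 2, (k ^ 2 + w x ^ 2) ^ (χ ^ N) := by
        apply integral_mono
        · exact ((continuous_const.add (hw.pow 2)).pow m).continuousOn.integrableOn_compact
            (isCompact_closedBall _ _)
        · exact (hcont w _ hw).continuousOn.integrableOn_compact (isCompact_closedBall _ _)
        · intro x
          beta_reduce
          rw [← Real.rpow_natCast]
          exact Real.rpow_le_rpow_of_exponent_le (hq _) hN.le
    _ ≤ _ := by
        apply setIntegral_mono_set
        · exact (hcont w _ hw).continuousOn.integrableOn_compact (isCompact_closedBall _ _)
        · exact Filter.Eventually.of_forall fun x => Real.rpow_nonneg (by positivity) _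
        · exact (closedBall_subset_closedBall
            (by have : (0:ℝ) < (1 / 2) ^ N := by positivity
                linarith)).eventuallyLE

lemma exp_step {n : ℕ} {χ C : ℝ} {w : En n → ℝ} (hs : StepW n χ C w) (σ q : ℝ)
    (hσ : σ = 1 ∨ σ = -1) (hq : 1 ≤ q) (r R : ℝ) (hr : 0 < r) (hrR : r < R) (hR : R ≤ 3)
    (hRr : R - r ≤ 1) :
    ∫ x in closedBall (0 : En n) r, exp (2 * (q * χ) * (σ * w x)) ≤
      (C / (R - r) ^ 2 * ∫ x in closedBall (0 : En n) R, exp (2 * q * (σ * w x))) ^ χ := by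
  set s := 2 * q * σ with hsdef
  have hl : ∀ (b t : ℝ), HasDerivAt (fun t => exp (b * t)) (exp (b * t) * b) t := fun b t => by
    simpa using ((hasDerivAt_id t).const_mul b).exp
  have hsm : ∀ b : ℝ, ContDiff ℝ 1 (fun t => exp (b * t)) := fun b => by fun_prop
  have hF2 : ∀ t, exp (s / 2 * t) ^ 2 = exp (2 * q * (σ * t)) := fun t => by
    rw [← exp_nat_mul]; congr 1; rw [hsdef]; push_cast; ring
  have hF3 : ∀ t, |exp (s / 2 * t)| ^ (2 * χ) = exp (2 * (q * χ) * (σ * t)) := fun t => by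
    rw [abs_of_pos (exp_pos _), ← exp_mul]; congr 1; rw [hsdef]; ring
  have hs1 : 0 < |s - 1| := by
    rw [abs_pos, hsdef]
    rcases hσ with h | h <;> rw [h] <;> intro h' <;> linarith
  have h := hs (fun t => exp (s / 2 * t)) (fun t => exp (s * t)) (hsm _) (hsm _) |s - 1| 1
    hs1 le_rfl (fun t => (exp_pos _).le)
    (by
      rcases hσ with h | h
      · left
        intro t
        rw [(hl s t).deriv, abs_of_pos (by rw [hsdef, h]; linarith)]
        linarith
      · right
        intro t
        rw [(hl s t).deriv, abs_of_neg (by rw [hsdef, h]; linarith)]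
        linarith)
    (fun t => by
      rw [(hl (s / 2) t).deriv, mul_pow, hF2, sq_abs, mul_comm]
      have : exp (2 * q * (σ * t)) = exp (s * t) := by rw [hsdef]; congr 1; ring
      rw [this]
      apply mul_le_mul_of_nonneg_right _ (exp_pos _).le
      rw [hsdef]
      rcases hσ with h | h <;> rw [h] <;> nlinarith)
    (fun t => by
      rw [hF2, one_mul, hsdef]
      apply le_of_eq; congr 1; ring)
    r R hr hrR hR hRr
  simp only [hF2, hF3, mul_one] at h
  exact h

lemma moser (n : ℕ) (χ C : ℝ) (hχ : 1 < χ) (hC : 1 ≤ C) :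
    ∃ B β : ℝ, 0 < B ∧ 0 < β ∧ ∀ w : En n → ℝ, Continuous w → StepW n χ C w →
      ∀ σ : ℝ, (σ = 1 ∨ σ = -1) → ∀ r δ : ℝ, 0 < r → 0 < δ → δ ≤ 1 → r + δ ≤ 3 →
      ∀ x ∈ closedBall (0 : En n) r, exp (2 * (σ * w x)) ≤
        B * (δ⁻¹) ^ β * ∫ x in closedBall (0 : En n) (r + δ), exp (2 * (σ * w x)) := by
  have hχ1 : 0 < χ - 1 := by linarith
  set α := χ / (χ - 1) with hα
  have hα0 : 0 < α := by positivity
  have hαe : χ * α = χ + α := by rw [hα]; field_simp; ring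
  set γ := α / (χ - 1) with hγ
  have hγ0 : 0 < γ := by positivity
  have hγe : χ * γ = α + γ := by rw [hγ]; field_simp; ring
  refine ⟨(4 * C) ^ α * 4 ^ γ, 2 * α, by positivity, by positivity, ?_⟩
  intro w hw hs σ hσ r δ hr hδ hδ1 hrδ x hx
  set g : En n → ℝ := fun x => σ * w x with hg
  have hgc : Continuous g := continuous_const.mul hw
  set ρ : ℕ → ℝ := fun j => r + δ * (1 / 2) ^ j with hρ
  have hρr : ∀ j, r < ρ j := fun j => by
    have : (0:ℝ) < δ * (1 / 2) ^ j := by positivity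
    simp only [hρ]; linarith
  have hIntg : ∀ (b ρ : ℝ), IntegrableOn (fun x => exp (b * g x)) (closedBall (0 : En n) ρ) :=
    fun b ρ => ((continuous_const.mul hgc).rexp).continuousOn.integrableOn_compact
      (isCompact_closedBall _ _)
  set I : ℕ → ℝ := fun j => ∫ x in closedBall (0 : En n) (ρ j), exp (2 * χ ^ j * g x) with hI
  have hIpos : ∀ j, 0 < I j := fun j => by
    simp only [hI]
    rw [setIntegral_pos_iff_support_of_nonneg_ae]
    · have : Function.support (fun x => exp (2 * χ ^ j * g x)) = Set.univ := by
        ext y; simp [(exp_pos _).ne']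
      rw [this, Set.univ_inter]
      exact measure_closedBall_pos _ _ (hr.trans (hρr j))
    · exact Filter.Eventually.of_forall fun x => (exp_pos _).le
    · exact hIntg _ _
  set b := log 4 with hb
  have hb0 : 0 < b := log_pos (by norm_num)
  set A := log (4 * C / δ ^ 2) with hA
  have hδ2 : δ ^ 2 ≤ 1 := pow_le_one₀ hδ.le hδ1
  have hA0 : 0 ≤ A := by
    apply log_nonneg
    rw [le_div_iff₀ (by positivity)]; linarith
  have hstep : ∀ j : ℕ, log (I (j + 1)) ≤ χ * (A + j * b + log (I j)) := by
    intro j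
    have h0 : (0:ℝ) < (1 / 2) ^ j := by positivity
    have h3 : ((1:ℝ) / 2) ^ j ≤ 1 := pow_le_one₀ (by norm_num) (by norm_num)
    have e : ρ j - ρ (j + 1) = δ * (1 / 2) ^ j / 2 := by
      simp only [hρ]; rw [pow_succ]; ring
    have h1 := exp_step hs σ (χ ^ j) hσ (one_le_pow₀ hχ.le) (ρ (j + 1)) (ρ j)
      (hr.trans (hρr _)) (by
        have : 0 < δ * (1 / 2) ^ j / 2 := by positivity
        linarith) (by simp only [hρ]; nlinarith) (by rw [e]; nlinarith)
    rw [← pow_succ] at h1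
    change I (j + 1) ≤ (_ * I j) ^ χ at h1
    have h5 := log_le_log (hIpos (j + 1)) h1
    have h6 : 0 < C / (ρ j - ρ (j + 1)) ^ 2 := by rw [e]; positivity
    have e6 : C / (ρ j - ρ (j + 1)) ^ 2 = 4 * C / δ ^ 2 * 4 ^ j := by
      rw [e]
      have : ((1:ℝ) / 2) ^ j = (2 ^ j)⁻¹ := by rw [one_div, inv_pow]
      rw [this]
      have h4 : (4:ℝ) ^ j = (2 ^ j) ^ 2 := by rw [← pow_mul, mul_comm, pow_mul]; norm_num
      rw [h4]
      field_simp
      try norm_num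
    rw [log_rpow (mul_pos h6 (hIpos j)), log_mul h6.ne' (hIpos j).ne', e6,
      log_mul (by positivity) (by positivity), log_pow] at h5
    exact h5
  set D := log (I 0) + α * A + γ * b with hD
  have hind : ∀ j : ℕ, log (I j) + α * A + α * j * b + γ * b ≤ χ ^ j * D := by
    intro j
    induction j with
    | zero => simp [hD]
    | succ j ih =>
      have h1 := hstep j
      have h2 := mul_le_mul_of_nonneg_left ih (show 0 ≤ χ by linarith)
      rw [pow_succ]
      push_cast
      have e1 : χ * (log (I j) + α * A + α * j * b + γ * b) =
        χ * log (I j) + (χ * α) * A + (χ * α) * j * b + (χ * γ) * b := by ring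
      rw [e1, hαe, hγe] at h2
      nlinarith
  have hIle : ∀ j : ℕ, I j ≤ exp (χ ^ j * D) := by
    intro j
    rw [← log_le_iff_le_exp (hIpos j)]
    have h1 := hind j
    have : 0 ≤ α * A + α * j * b + γ * b := by positivity
    linarith
  -- pointwise bound
  have hpt : 2 * g x ≤ D := by
    by_contra hcon
    push Not at hcon
    obtain ⟨D', hD1, hD2⟩ := exists_between hcon
    set V : Set (En n) := {y | D' < 2 * g y} ∩ ball 0 r with hV
    have hUo : IsOpen {y | D' < 2 * g y} := isOpen_lt continuous_const (continuous_const.mul hgc)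
    have hVo : IsOpen V := hUo.inter isOpen_ball
    have hVn : V.Nonempty := by
      rw [← closure_ball _ hr.ne', _root_.mem_closure_iff] at hx
      exact hx _ hUo hD2
    have hVpos : 0 < volume V := hVo.measure_pos _ hVn
    have hVr : V ⊆ closedBall 0 r := fun y hy => ball_subset_closedBall hy.2
    have hVfin : volume V < ⊤ := lt_of_le_of_lt (measure_mono hVr) measure_closedBall_lt_top
    have hv : 0 < volume.real V := ENNReal.toReal_pos hVpos.ne' hVfin.ne
    have hlow : ∀ j : ℕ, volume.real V * exp (χ ^ j * D') ≤ exp (χ ^ j * D) := by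
      intro j
      refine le_trans ?_ (hIle j)
      have hVsub : V ⊆ closedBall 0 (ρ j) :=
        hVr.trans (closedBall_subset_closedBall (hρr j).le)
      calc volume.real V * exp (χ ^ j * D') = ∫ x in V, exp (χ ^ j * D') := by
            rw [setIntegral_const, smul_eq_mul]
        _ ≤ ∫ x in V, exp (2 * χ ^ j * g x) := by
            apply setIntegral_mono_on
            · exact integrableOn_const hVfin.ne
            · exact (hIntg _ _).mono_set hVsub
            · exact hVo.measurableSet
            · intro y hy
              apply exp_le_exp.mpr
              have : 0 < χ ^ j := by positivity
              have h2 : D' < 2 * g y := hy.1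
              nlinarith
        _ ≤ I j := by
            apply setIntegral_mono_set (hIntg _ _)
            · exact Filter.Eventually.of_forall fun x => (exp_pos _).le
            · exact hVsub.eventuallyLE
    have hd : 0 < D' - D := by linarith
    obtain ⟨j, hj⟩ := pow_unbounded_of_one_lt ((1 / volume.real V) / (D' - D)) hχ
    have h1 := hlow j
    have h2 : 1 / volume.real V < χ ^ j * (D' - D) := by
      rwa [div_lt_iff₀ hd] at hj
    have h3 : χ ^ j * (D' - D) < exp (χ ^ j * (D' - D)) := by
      have := add_one_le_exp (χ ^ j * (D' - D)); linarith
    have h4 : 1 < volume.real V * exp (χ ^ j * (D' - D)) := by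
      have := h2.trans h3
      rw [div_lt_iff₀ hv] at this
      linarith
    have e4 : exp (χ ^ j * D') = exp (χ ^ j * (D' - D)) * exp (χ ^ j * D) := by
      rw [← exp_add]; congr 1; ring
    rw [e4, ← mul_assoc] at h1
    have := exp_pos (χ ^ j * D)
    nlinarith
  refine (exp_le_exp.mpr hpt).trans (le_of_eq ?_)
  have e1 : exp D = I 0 * ((4 * C / δ ^ 2) ^ α) * 4 ^ γ := by
    rw [hD, exp_add, exp_add, exp_log (hIpos 0), Real.rpow_def_of_pos (by positivity),
      Real.rpow_def_of_pos (by norm_num), mul_comm α, mul_comm γ]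
  have e2 : (4 * C / δ ^ 2) ^ α = (4 * C) ^ α * (δ⁻¹) ^ (2 * α) := by
    rw [Real.rpow_mul (by positivity), ← Real.mul_rpow (by positivity) (by positivity)]
    congr 1
    rw [div_eq_mul_inv]
    congr 1
    rw [← inv_pow]
    norm_cast
  have e3 : I 0 = ∫ x in closedBall (0 : En n) (r + δ), exp (2 * g x) := by
    simp [hI, hρ]
  rw [e1, e2, e3]
  ring

lemma exp_poly_bound (m : ℕ) (k t T : ℝ) (hk : 1 ≤ k) (hT : 1 ≤ T) (ht : t ≤ T) :
    exp (2 * t) * T ^ (2 * m) ≤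
      (4 ^ m + (2 * m).factorial) * exp (2 * T) * (k ^ 2 + t ^ 2) ^ m := by
  have hfac : (0:ℝ) < (2 * m).factorial := by exact_mod_cast Nat.factorial_pos _
  have hq : 1 ≤ k ^ 2 + t ^ 2 := by nlinarith [sq_nonneg t]
  have hqm : 1 ≤ (k ^ 2 + t ^ 2) ^ m := one_le_pow₀ hq
  by_cases h : T / 2 ≤ t
  · have h1 : T ^ 2 ≤ 4 * (k ^ 2 + t ^ 2) := by nlinarith
    have h2 : T ^ (2 * m) ≤ 4 ^ m * (k ^ 2 + t ^ 2) ^ m := by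
      rw [pow_mul, ← mul_pow]
      exact pow_le_pow_left₀ (by positivity) h1 m
    calc exp (2 * t) * T ^ (2 * m) ≤ exp (2 * T) * (4 ^ m * (k ^ 2 + t ^ 2) ^ m) := by gcongr
      _ = 4 ^ m * exp (2 * T) * (k ^ 2 + t ^ 2) ^ m := by ring
      _ ≤ _ := by
        gcongr
        linarith
  · push Not at h
    have h1 := Real.pow_div_factorial_le_exp T (by linarith) (2 * m)
    rw [div_le_iff₀ hfac] at h1
    calc exp (2 * t) * T ^ (2 * m) ≤ exp T * (exp T * (2 * m).factorial) := by
          gcongr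
          linarith
      _ = (2 * m).factorial * exp (2 * T) * 1 := by rw [two_mul T, exp_add]; ring
      _ ≤ _ := by
        gcongr
        have : (0:ℝ) < 4 ^ m := by positivity
        linarith

lemma growth_step {n : ℕ} {B β k P : ℝ} {m : ℕ} (hB : 0 < B) (hk : 1 ≤ k)
    (hm : β + 1 ≤ m) {g : En n → ℝ} (hg : Continuous g)
    (hmos : ∀ r δ : ℝ, 0 < r → 0 < δ → δ ≤ 1 → r + δ ≤ 3 →
      ∀ x ∈ closedBall (0 : En n) r, exp (2 * g x) ≤
        B * (δ⁻¹) ^ β * ∫ x in closedBall (0 : En n) (r + δ), exp (2 * g x))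
    (hmom : ∫ x in closedBall (0 : En n) 2, (k ^ 2 + g x ^ 2) ^ m ≤ P)
    (T : ℝ) (hT : 1 ≤ T) (hT2 : B * (4 ^ m + (2 * m).factorial) * P * exp 2 ≤ T)
    (r R : ℝ) (hr : 0 < r) (hR : R ≤ 2) (hrR : r + (T ^ 2)⁻¹ ≤ R)
    (hle : ∀ x ∈ closedBall (0 : En n) R, g x ≤ T) :
    ∀ x ∈ closedBall (0 : En n) r, g x ≤ T - 1 := by
  intro x hx
  have hT0 : 0 < T := by linarith
  have hδ : (T ^ 2)⁻¹ ≤ 1 := inv_le_one_of_one_le₀ (one_le_pow₀ hT)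
  have h1 := hmos r (T ^ 2)⁻¹ hr (by positivity) hδ (by linarith) x hx
  set c : ℝ := 4 ^ m + (2 * m).factorial with hc
  have hc0 : 0 < c := by positivity
  have hIntg : IntegrableOn (fun x => (k ^ 2 + g x ^ 2) ^ m) (closedBall (0 : En n) 2) :=
    ((continuous_const.add (hg.pow 2)).pow m).continuousOn.integrableOn_compact
      (isCompact_closedBall _ _)
  have hsub1 : closedBall (0 : En n) (r + (T ^ 2)⁻¹) ⊆ closedBall 0 2 :=
    closedBall_subset_closedBall (by linarith)
  have h2 : ∫ x in closedBall (0 : En n) (r + (T ^ 2)⁻¹), exp (2 * g x) ≤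
      c * exp (2 * T) / T ^ (2 * m) * P := by
    calc _ ≤ ∫ x in closedBall (0 : En n) (r + (T ^ 2)⁻¹),
          c * exp (2 * T) / T ^ (2 * m) * (k ^ 2 + g x ^ 2) ^ m := by
          apply setIntegral_mono_on
          · exact ((continuous_const.mul hg).rexp).continuousOn.integrableOn_compact
              (isCompact_closedBall _ _)
          · exact (hIntg.mono_set hsub1).const_mul _
          · exact measurableSet_closedBall
          · intro y hy
            have := exp_poly_bound m k (g y) T hk hT
              (hle y (closedBall_subset_closedBall hrR hy))
            rw [div_mul_eq_mul_div, le_div_iff₀ (by positivity)]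
            exact this
      _ = c * exp (2 * T) / T ^ (2 * m) * ∫ x in closedBall (0 : En n) (r + (T ^ 2)⁻¹),
          (k ^ 2 + g x ^ 2) ^ m := integral_const_mul _ _
      _ ≤ _ := by
          gcongr
          refine le_trans ?_ hmom
          apply setIntegral_mono_set hIntg
          · exact Filter.Eventually.of_forall fun x => by positivity
          · exact hsub1.eventuallyLE
  have hP : 0 ≤ P := le_trans (integral_nonneg fun x => by positivity) hmom
  have h3 : (((T ^ 2)⁻¹)⁻¹) ^ β ≤ T ^ (2 * m) / T ^ 2 := by
    rw [inv_inv]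
    calc (T ^ 2) ^ β ≤ (T ^ 2) ^ ((m : ℝ) - 1) :=
          Real.rpow_le_rpow_of_exponent_le (one_le_pow₀ hT) (by linarith)
      _ = _ := by
          rw [Real.rpow_sub_one (by positivity), Real.rpow_natCast, ← pow_mul]
  have h4 : exp (2 * g x) ≤ exp (2 * (T - 1)) := by
    calc exp (2 * g x) ≤ B * (T ^ (2 * m) / T ^ 2) * (c * exp (2 * T) / T ^ (2 * m) * P) := by
          refine h1.trans ?_
          gcongr
      _ = (B * c * P) * exp (2 * T) / T ^ 2 := by
          field_simp
      _ ≤ exp (2 * (T - 1)) := by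
          rw [div_le_iff₀ (by positivity)]
          have e1 : exp (2 * T) = exp (2 * (T - 1)) * exp 2 := by
            rw [← exp_add]; congr 1; ring
          have e2 : T ≤ T ^ 2 := by nlinarith
          calc (B * c * P) * exp (2 * T) = exp (2 * (T - 1)) * (B * c * P * exp 2) := by
                rw [e1]; ring
            _ ≤ exp (2 * (T - 1)) * T ^ 2 := by
                gcongr
                linarith
  have := exp_le_exp.mp h4
  linarith

lemma growth {n : ℕ} {B β k P : ℝ} {m : ℕ} (hB : 0 < B) (hk : 1 ≤ k)
    (hm : β + 1 ≤ m) {g : En n → ℝ} (hg : Continuous g)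
    (hmos : ∀ r δ : ℝ, 0 < r → 0 < δ → δ ≤ 1 → r + δ ≤ 3 →
      ∀ x ∈ closedBall (0 : En n) r, exp (2 * g x) ≤
        B * (δ⁻¹) ^ β * ∫ x in closedBall (0 : En n) (r + δ), exp (2 * g x))
    (hmom : ∫ x in closedBall (0 : En n) 2, (k ^ 2 + g x ^ 2) ^ m ≤ P)
    (L : ℝ) (hL : 1 ≤ L) (hL2 : B * (4 ^ m + (2 * m).factorial) * P * exp 2 ≤ L) :
    ∀ x ∈ closedBall (0 : En n) 1, g x ≤ L := by
  by_contra hcon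
  push Not at hcon
  have hL0 : 0 < L := by linarith
  have hLinv : 1 / L ≤ 1 := by rw [div_le_one hL0]; exact hL
  set ρ : ℕ → ℝ := fun j => 1 + 1 / L - 1 / (L + j) with hρ
  have hρ2 : ∀ j, ρ j ≤ 2 := fun j => by
    have : 0 < 1 / (L + j) := by positivity
    simp only [hρ]; linarith
  have hρ0 : ∀ j, 0 < ρ j := fun j => by
    have : 1 / (L + j) ≤ 1 / L := by
      apply one_div_le_one_div_of_le hL0
      have : (0:ℝ) ≤ j := Nat.cast_nonneg j
      linarith
    simp only [hρ]; linarith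
  have key : ∀ j : ℕ, ∃ x ∈ closedBall (0 : En n) (ρ j), L + j < g x := by
    intro j
    induction j with
    | zero => simpa [hρ] using hcon
    | succ j ih =>
      by_contra hno
      push Not at hno
      obtain ⟨x, hx, hxg⟩ := ih
      have hj : (0:ℝ) ≤ j := Nat.cast_nonneg j
      have := growth_step hB hk hm hg hmos hmom (L + (j + 1 : ℕ)) (by push_cast; linarith)
        (by push_cast; linarith) (ρ j) (ρ (j + 1)) (hρ0 j) (hρ2 _) (by
          simp only [hρ]
          push_cast
          have h1 : 0 < L + j := by linarith
          have h2 : ((L + (j + 1)) ^ 2)⁻¹ ≤ 1 / (L + j) - 1 / (L + (j + 1)) := by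
            rw [div_sub_div _ _ h1.ne' (by positivity), inv_eq_one_div,
              div_le_div_iff₀ (by positivity) (by positivity)]
            nlinarith
          linarith) hno x hx
      push_cast at this
      linarith
  obtain ⟨b, hb⟩ := (isCompact_closedBall (0 : En n) 2).bddAbove_image hg.continuousOn
  obtain ⟨j, hj⟩ := exists_nat_gt b
  obtain ⟨x, hx, hxg⟩ := key j
  have := hb ⟨x, closedBall_subset_closedBall (hρ2 j) hx, rfl⟩
  linarith

/-- The De Giorgi–Nash–Moser Harnack inequality: for measurable uniformly elliptic
coefficients `ε Iₙ ≤ a(x) ≤ ε⁻¹ Iₙ` there is a constant `C = C(n, ε)` such that every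
nonnegative `C¹` weak solution `f` of `∂_j(aⁱʲ ∂_i f) = 0` on `B₄(0)` satisfies
`sup_{B₁(0)} f ≤ C inf_{B₁(0)} f` (stated pointwise: `f x ≤ C * f y` for `x, y ∈ B₁(0)`). -/
theorem harnack_de_giorgi_nash_moser
    (n : ℕ) (hn : 1 ≤ n) (ε : ℝ) (hε : 0 < ε) :
    ∃ C : ℝ, ∀ (a : En n → Matrix (Fin n) (Fin n) ℝ),
      (∀ i j, Measurable fun x => a x i j) →
      (∀ x, (a x - ε • (1 : Matrix (Fin n) (Fin n) ℝ)).PosSemidef ∧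
        ((ε⁻¹ : ℝ) • (1 : Matrix (Fin n) (Fin n) ℝ) - a x).PosSemidef) →
      ∀ f : En n → ℝ,
        ContDiffOn ℝ 1 f (ball (0 : En n) 4) →
        (∀ x ∈ ball (0 : En n) 4, 0 ≤ f x) →
        (∀ φ : En n → ℝ, ContDiff ℝ (⊤ : ℕ∞) φ → HasCompactSupport φ →
          tsupport φ ⊆ ball (0 : En n) 4 →
          ∫ x in ball (0 : En n) 4, (a x *ᵥ gradv n f x) ⬝ᵥ gradv n φ x = 0) →
        ∀ x ∈ ball (0 : En n) 1, ∀ y ∈ ball (0 : En n) 1, f x ≤ C * f y := by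
  obtain ⟨χ, hχ, S, hS, hstep⟩ := step n hn ε hε
  obtain ⟨A, hA, hlog⟩ := log_estimate n ε hε
  obtain ⟨B, β, hB, hβ, hmos⟩ := moser n χ S hχ hS
  set m : ℕ := ⌈β + 1⌉₊ with hm
  obtain ⟨k, P, hk, hP, hmom⟩ := moments n χ S hχ hS m A
  set L : ℝ := 1 + B * (4 ^ m + (2 * m).factorial) * P * exp 2 with hL
  have hL1 : 0 ≤ B * (4 ^ m + (2 * m).factorial) * P * exp 2 := by positivity
  refine ⟨exp (2 * L), ?_⟩
  intro a ha1 ha2 f hf hf0 hweak x hx y hy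
  have ha : Ell n ε a := ⟨ha1, ha2⟩
  have main : ∀ δ : ℝ, 0 < δ → f x + δ ≤ exp (2 * L) * (f y + δ) := by
    intro δ hδ
    obtain ⟨w, hw, hwf⟩ := exists_sol ha hε f hf hf0 hweak δ hδ
    obtain ⟨c, hc⟩ := hlog a w ha hw
    have hv := hw.sub_const c
    set v : En n → ℝ := fun x => w x - c with hvdef
    have hvc : Continuous v := hv.1.continuous
    have hsv : StepW n χ S v := hstep a v ha hv
    have hmomv := hmom v hvc hsv hc
    have hup : ∀ z ∈ closedBall (0 : En n) 1, v z ≤ L := by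
      refine growth hB hk (Nat.le_ceil _) hvc (fun r δ h1 h2 h3 h4 z hz => ?_) hmomv L
        (by linarith) (by linarith)
      have := hmos v hvc hsv 1 (Or.inl rfl) r δ h1 h2 h3 h4 z hz
      simpa using this
    have hlow : ∀ z ∈ closedBall (0 : En n) 1, -v z ≤ L := by
      refine growth (g := fun z => -v z) hB hk (Nat.le_ceil _) hvc.neg
        (fun r δ h1 h2 h3 h4 z hz => ?_) (by simpa using hmomv) L
        (by linarith) (by linarith)
      have := hmos v hvc hsv (-1) (Or.inr rfl) r δ h1 h2 h3 h4 z hz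
      simpa using this
    have hb3 : ball (0 : En n) 1 ⊆ closedBall 0 3 :=
      ball_subset_closedBall.trans (closedBall_subset_closedBall (by norm_num))
    rw [← hwf x (hb3 hx), ← hwf y (hb3 hy), ← exp_add]
    apply exp_le_exp.mpr
    have h1 := hup x (ball_subset_closedBall hx)
    have h2 := hlow y (ball_subset_closedBall hy)
    simp only [hvdef] at h1 h2
    linarith
  apply le_of_forall_pos_le_add
  intro e he
  have hE := exp_pos (2 * L)
  have h := main (e / exp (2 * L)) (by positivity)
  have e2 : exp (2 * L) * (f y + e / exp (2 * L)) = exp (2 * L) * f y + e := by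
    field_simp
  rw [e2] at h
  have : 0 < e / exp (2 * L) := by positivity
  linarith
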